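/- Let Ω ⊂ ℝ^d be a nonempty bounded domain with smooth boundary. For every integer N ≥ 2 there is a constant C such that for every u ∈ C^∞(ℝ_+×ℝ³×Ω̄) satisfying either u|_{y∈∂Ω}=0 or ∂_ν u|_{y∈∂Ω}=0, and every (t,x): Σ_{|α|≤N} ‖∂_y^α u(t,x,·)‖_{L²(Ω)} ≤ C Σ_{|α|+|β|≤N, |β|≤1} ‖∂_{t,x}^α ∂_y^β u(t,x,·)‖_{L²(Ω)} + C Σ_{|α|≤N−2} ‖∂_{t,x,y}^α □u(t,x,·)‖_{L²(Ω)}. -/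

import Mathlib

open MeasureTheory

noncomputable section

/-- The partial derivative in the `i`-th coordinate direction on `ℝⁿ`. -/
def pd {n : ℕ} (i : Fin n) (u : (Fin n → ℝ) → ℝ) : (Fin n → ℝ) → ℝ :=
  fun z => fderiv ℝ u z (Pi.single i 1)

/-- Iterated application of a family of first-order operators along a list of indices. -/
def opIter {α γ : Type*} (F : α → γ → γ) : List α → γ → γ
  | [] => id
  | i :: L => fun u => F i (opIter F L u)

/-- A nonempty bounded domain `Ω ⊂ ℝ^d` with smooth boundary, described by a smooth global
defining function: `Ω = {ρ < 0}`, `∂Ω = {ρ = 0}` and `∇ρ ≠ 0` on `∂Ω` (so `∇ρ` points in the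
outward normal direction along the boundary). -/
structure SmoothDomain (d : ℕ) where
  carrier : Set (Fin d → ℝ)
  isConnected : IsConnected carrier
  isOpen : IsOpen carrier
  isBounded : Bornology.IsBounded carrier
  defFun : (Fin d → ℝ) → ℝ
  defFun_smooth : ContDiff ℝ (⊤ : ℕ∞) defFun
  carrier_eq : carrier = {y | defFun y < 0}
  frontier_eq : frontier carrier = {y | defFun y = 0}
  grad_ne : ∀ y ∈ frontier carrier, fderiv ℝ defFun y ≠ 0

/-- The normal derivative `∂_ν h` on `∂Ω` (computed against the outward normal direction
`∇ρ`; it vanishes iff the genuine normal derivative does). -/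
def SmoothDomain.nder {d : ℕ} (D : SmoothDomain d) (h : (Fin d → ℝ) → ℝ)
    (y : Fin d → ℝ) : ℝ :=
  ∑ i : Fin d, fderiv ℝ D.defFun y (Pi.single i 1) * fderiv ℝ h y (Pi.single i 1)

/-- Partial derivative in the `i`-th `(t,x)` direction of a function on `(ℝ×ℝ³) × ℝ^d`
(coordinates of the first factor: `0 = t`, `1,2,3 = x`). -/
def pdtx {d : ℕ} (i : Fin 4) (u : (Fin 4 → ℝ) → (Fin d → ℝ) → ℝ) :
    (Fin 4 → ℝ) → (Fin d → ℝ) → ℝ :=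
  fun z y => fderiv ℝ (fun z' => u z' y) z (Pi.single i 1)

/-- Partial derivative in the `j`-th `y` direction of a function on `(ℝ×ℝ³) × ℝ^d`. -/
def pdy {d : ℕ} (j : Fin d) (u : (Fin 4 → ℝ) → (Fin d → ℝ) → ℝ) :
    (Fin 4 → ℝ) → (Fin d → ℝ) → ℝ :=
  fun z y => fderiv ℝ (fun y' => u z y') y (Pi.single j 1)

/-- A partial derivative in any of the `t,x,y` directions. -/
def pdmix {d : ℕ} : Fin 4 ⊕ Fin d →
    ((Fin 4 → ℝ) → (Fin d → ℝ) → ℝ) → ((Fin 4 → ℝ) → (Fin d → ℝ) → ℝ)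
  | Sum.inl i => pdtx i
  | Sum.inr j => pdy j

/-- The d'Alembertian `□ = ∂_t² - Δ_{ℝ³} - Δ_Ω` on the waveguide `ℝ×ℝ³×ℝ^d`. -/
def wBox {d : ℕ} (u : (Fin 4 → ℝ) → (Fin d → ℝ) → ℝ) :
    (Fin 4 → ℝ) → (Fin d → ℝ) → ℝ :=
  fun z y => pdtx 0 (pdtx 0 u) z y - pdtx 1 (pdtx 1 u) z y - pdtx 2 (pdtx 2 u) z y -
    pdtx 3 (pdtx 3 u) z y - ∑ j : Fin d, pdy j (pdy j u) z y

/-- Smoothness of a function of `((t,x),y)`, jointly in all variables. -/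
def SmoothC {d : ℕ} (u : (Fin 4 → ℝ) → (Fin d → ℝ) → ℝ) : Prop :=
  ContDiff ℝ (⊤ : ℕ∞) (fun p : (Fin 4 → ℝ) × (Fin d → ℝ) => u p.1 p.2)

/-- The Dirichlet boundary condition `u|_{y ∈ ∂Ω} = 0`. -/
def DirichletBC {d : ℕ} (D : SmoothDomain d) (u : (Fin 4 → ℝ) → (Fin d → ℝ) → ℝ) : Prop :=
  ∀ z : Fin 4 → ℝ, ∀ y ∈ frontier D.carrier, u z y = 0

/-- The Neumann boundary condition `∂_ν u|_{y ∈ ∂Ω} = 0`. -/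
def NeumannBC {d : ℕ} (D : SmoothDomain d) (u : (Fin 4 → ℝ) → (Fin d → ℝ) → ℝ) : Prop :=
  ∀ z : Fin 4 → ℝ, ∀ y ∈ frontier D.carrier, D.nder (u z) y = 0

/-- The `L²(Ω)` norm of `u(t,x,·)` at fixed `(t,x)`. -/
def L2y {d : ℕ} (D : SmoothDomain d) (u : (Fin 4 → ℝ) → (Fin d → ℝ) → ℝ)
    (z : Fin 4 → ℝ) : ℝ :=
  Real.sqrt (∫ y in D.carrier, (u z y)^2)

section EllipticRegularity

open scoped ContDiff Topology
open Filter Set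

/-- The algebra of smooth real functions on a normed space. -/
def smoothAlg (E : Type*) [NormedAddCommGroup E] [NormedSpace ℝ E] : Subalgebra ℝ (E → ℝ) where
  carrier := {f | ContDiff ℝ ∞ f}
  mul_mem' {f g} (hf : ContDiff ℝ ∞ f) (hg : ContDiff ℝ ∞ g) :=
    show ContDiff ℝ ∞ (f * g) from hf.mul hg
  add_mem' {f g} (hf : ContDiff ℝ ∞ f) (hg : ContDiff ℝ ∞ g) :=
    show ContDiff ℝ ∞ (f + g) from hf.add hg
  algebraMap_mem' c := show ContDiff ℝ ∞ (fun _ => c) from contDiff_const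

/-- Smooth real functions on a normed space. -/
abbrev Sm (E : Type*) [NormedAddCommGroup E] [NormedSpace ℝ E] : Type _ := smoothAlg E

namespace Sm

section Calculus

variable {E : Type*} [NormedAddCommGroup E] [NormedSpace ℝ E]

lemma contDiff (f : Sm E) : ContDiff ℝ ∞ (f : E → ℝ) := f.2

lemma differentiable (f : Sm E) : Differentiable ℝ (f : E → ℝ) :=
  f.contDiff.differentiable (by simp)

lemma continuous (f : Sm E) : Continuous (f : E → ℝ) := f.contDiff.continuous

lemma differentiable_fderiv (f : Sm E) : Differentiable ℝ (fderiv ℝ (f : E → ℝ)) :=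
  (f.contDiff.fderiv_right (m := ∞) (by simp)).differentiable (by simp)

@[simp] lemma coe_sum {ι : Type*} (s : Finset ι) (f : ι → Sm E) (x : E) :
    ((∑ i ∈ s, f i : Sm E) : E → ℝ) x = ∑ i ∈ s, (f i : E → ℝ) x := by
  simp [Finset.sum_apply]

/-- The directional derivative in the direction `e`. -/
def dd (e : E) : Sm E →ₗ[ℝ] Sm E where
  toFun f := ⟨fun x => fderiv ℝ (f : E → ℝ) x e,
    show ContDiff ℝ ∞ (fun x => fderiv ℝ (f : E → ℝ) x e) from
      (f.contDiff.fderiv_right (m := ∞) (by simp)).clm_apply contDiff_const⟩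
  map_add' f g := by
    ext x
    simp [fderiv_add (f.differentiable x) (g.differentiable x)]
  map_smul' c f := by
    ext x
    simp [fderiv_const_smul (f.differentiable x)]

lemma dd_apply (e : E) (f : Sm E) (x : E) : (dd e f : E → ℝ) x = fderiv ℝ f x e := rfl

lemma dd_mul (e : E) (f g : Sm E) : dd e (f * g) = dd e f * g + f * dd e g := by
  ext x
  simp [dd_apply, fderiv_mul (f.differentiable x) (g.differentiable x)]
  ring

lemma dd_comm (e e' : E) (f : Sm E) : dd e (dd e' f) = dd e' (dd e f) := by
  have key : ∀ (a b : E) (x : E), (dd a (dd b f) : E → ℝ) x =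
      fderiv ℝ (fderiv ℝ (f : E → ℝ)) x a b := by
    intro a b x
    have h : HasFDerivAt (fun y => fderiv ℝ (f : E → ℝ) y b)
        ((ContinuousLinearMap.apply ℝ ℝ b).comp (fderiv ℝ (fderiv ℝ (f : E → ℝ)) x)) x :=
      (ContinuousLinearMap.apply ℝ ℝ b).hasFDerivAt.comp x
        (f.differentiable_fderiv x).hasFDerivAt
    change fderiv ℝ (fun y => fderiv ℝ (f : E → ℝ) y b) x a = _
    rw [h.fderiv]
    rfl
  ext x
  rw [key, key]
  exact (f.contDiff.contDiffAt.isSymmSndFDerivAt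
    (by simpa using ENat.LEInfty.out)) e e'

lemma dd_eq_sum {d : ℕ} (w : Sm (Fin d → ℝ)) (y e : Fin d → ℝ) :
    fderiv ℝ w y e = ∑ i, e i * (dd (Pi.single i 1) w : (Fin d → ℝ) → ℝ) y := by
  conv_lhs => rw [pi_eq_sum_univ' e]
  simp [dd_apply]

end Calculus

end Sm

/-- `A` is bounded by a constant multiple of `B`. -/
def Dom {α : Type*} (A B : α → ℝ) : Prop := ∃ C, 0 ≤ C ∧ ∀ a, A a ≤ C * B a

namespace Dom

variable {α β : Type*} {A A' B B' : α → ℝ}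

lemma of_le (h : ∀ a, A a ≤ B a) : Dom A B := ⟨1, zero_le_one, by simpa using h⟩

lemma trans {C : α → ℝ} (h : Dom A B) (h' : Dom B C) : Dom A C := by
  obtain ⟨c, hc, h⟩ := h
  obtain ⟨c', hc', h'⟩ := h'
  refine ⟨c * c', by positivity, fun a => (h a).trans ?_⟩
  rw [mul_assoc]
  exact mul_le_mul_of_nonneg_left (h' a) hc

lemma mono_left (h : Dom A' B) (hA : ∀ a, A a ≤ A' a) : Dom A B := (of_le hA).trans h

lemma mono_right (h : Dom A B) (hB : ∀ a, B a ≤ B' a) : Dom A B' := h.trans (of_le hB)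

lemma add (h : Dom A B) (h' : Dom A' B) : Dom (fun a => A a + A' a) B := by
  obtain ⟨c, hc, h⟩ := h
  obtain ⟨c', hc', h'⟩ := h'
  refine ⟨c + c', by positivity, fun a => ?_⟩
  rw [add_mul]
  exact add_le_add (h a) (h' a)

lemma sum {ι : Type*} {s : Finset ι} {A : ι → α → ℝ} (hB : ∀ a, 0 ≤ B a)
    (h : ∀ i ∈ s, Dom (A i) B) : Dom (fun a => ∑ i ∈ s, A i a) B := by
  classical
  induction s using Finset.induction_on with
  | empty => exact of_le (by simpa using hB)
  | insert i s hi ih =>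
    simp only [Finset.sum_insert hi]
    exact (h i (by simp)).add (ih fun j hj => h j (by simp [hj]))

lemma comp (h : Dom A B) (f : β → α) : Dom (fun b => A (f b)) (fun b => B (f b)) := by
  obtain ⟨c, hc, h⟩ := h
  exact ⟨c, hc, fun b => h (f b)⟩

end Dom

namespace SmoothDomain

variable {d : ℕ} (D : SmoothDomain d)

lemma isCompact_closure : IsCompact (closure D.carrier) := D.isBounded.isCompact_closure

lemma measure_lt_top : volume D.carrier < ⊤ :=
  (measure_mono subset_closure).trans_lt D.isCompact_closure.measure_lt_top

instance : IsFiniteMeasure (volume.restrict D.carrier) :=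
  ⟨by simpa using D.measure_lt_top⟩

/-- The defining function as a smooth function. -/
def rho : Sm (Fin d → ℝ) := ⟨D.defFun, D.defFun_smooth⟩

lemma rho_neg_iff {y : Fin d → ℝ} : (D.rho : (Fin d → ℝ) → ℝ) y < 0 ↔ y ∈ D.carrier := by
  rw [D.carrier_eq]; rfl

lemma rho_eq_zero_iff {y : Fin d → ℝ} :
    (D.rho : (Fin d → ℝ) → ℝ) y = 0 ↔ y ∈ frontier D.carrier := by
  rw [D.frontier_eq]; rfl

lemma exists_bound (f : Sm (Fin d → ℝ)) :
    ∃ C, 0 ≤ C ∧ ∀ y ∈ D.carrier, |(f : (Fin d → ℝ) → ℝ) y| ≤ C := by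
  obtain ⟨C, hC⟩ := D.isCompact_closure.exists_bound_of_continuousOn f.continuous.continuousOn
  exact ⟨max C 0, le_max_right _ _, fun y hy => (hC y (subset_closure hy)).trans (le_max_left _ _)⟩

lemma integrableOn (f : Sm (Fin d → ℝ)) : IntegrableOn (f : (Fin d → ℝ) → ℝ) D.carrier :=
  (f.continuous.continuousOn.integrableOn_compact D.isCompact_closure).mono_set subset_closure

/-- The `L²(Ω)` inner product of smooth functions. -/
def ip : LinearMap.BilinForm ℝ (Sm (Fin d → ℝ)) :=
  LinearMap.mk₂ ℝ (fun f g => ∫ y in D.carrier, ((f * g : Sm (Fin d → ℝ)) : (Fin d → ℝ) → ℝ) y)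
    (fun f f' g => by
      rw [add_mul]
      exact integral_add (D.integrableOn _) (D.integrableOn _))
    (fun c f g => by
      rw [smul_mul_assoc]
      exact integral_smul c _)
    (fun f g g' => by
      rw [mul_add]
      exact integral_add (D.integrableOn _) (D.integrableOn _))
    (fun c f g => by
      rw [mul_smul_comm]
      exact integral_smul c _)

lemma ip_apply (f g : Sm (Fin d → ℝ)) :
    D.ip f g = ∫ y in D.carrier, ((f * g : Sm (Fin d → ℝ)) : (Fin d → ℝ) → ℝ) y := rfl

lemma ip_comm (f g : Sm (Fin d → ℝ)) : D.ip f g = D.ip g f := by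
  rw [ip_apply, ip_apply, mul_comm]

lemma ip_mul_left (a f g : Sm (Fin d → ℝ)) : D.ip (a * f) g = D.ip f (a * g) := by
  rw [ip_apply, ip_apply]
  congr! 3
  ring

lemma ip_self_nonneg (f : Sm (Fin d → ℝ)) : 0 ≤ D.ip f f :=
  integral_nonneg fun y => mul_self_nonneg ((f : (Fin d → ℝ) → ℝ) y)

/-- The `L²(Ω)` seminorm of a smooth function. -/
def nrm (f : Sm (Fin d → ℝ)) : ℝ := Real.sqrt (D.ip f f)

lemma nrm_nonneg (f : Sm (Fin d → ℝ)) : 0 ≤ D.nrm f := Real.sqrt_nonneg _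

lemma nrm_sq (f : Sm (Fin d → ℝ)) : D.nrm f ^ 2 = D.ip f f := Real.sq_sqrt (D.ip_self_nonneg f)

lemma ip_le (f g : Sm (Fin d → ℝ)) : D.ip f g ≤ D.nrm f * D.nrm g := by
  have h := D.ip.apply_mul_apply_le_of_forall_zero_le D.ip_self_nonneg f g
  rw [D.ip_comm g f] at h
  rw [nrm, nrm, ← Real.sqrt_mul (D.ip_self_nonneg f)]
  exact Real.le_sqrt_of_sq_le (by rwa [sq])

lemma nrm_add_le (f g : Sm (Fin d → ℝ)) : D.nrm (f + g) ≤ D.nrm f + D.nrm g := by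
  refine Real.sqrt_le_iff.2 ⟨add_nonneg (D.nrm_nonneg f) (D.nrm_nonneg g), ?_⟩
  have h := D.ip_le f g
  simp only [map_add, LinearMap.add_apply, D.ip_comm g f]
  nlinarith [D.nrm_sq f, D.nrm_sq g]

lemma nrm_neg (f : Sm (Fin d → ℝ)) : D.nrm (-f) = D.nrm f := by simp [nrm]

lemma nrm_zero : D.nrm 0 = 0 := by simp [nrm]

lemma nrm_mul_le (c : Sm (Fin d → ℝ)) : Dom (fun f => D.nrm (c * f)) D.nrm := by
  obtain ⟨C, hC, h⟩ := D.exists_bound c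
  refine ⟨C, hC, fun f => ?_⟩
  refine Real.sqrt_le_iff.2 ⟨mul_nonneg hC (D.nrm_nonneg f), ?_⟩
  rw [mul_pow, nrm_sq, ip_apply, ip_apply, ← integral_const_mul]
  refine setIntegral_mono_on (D.integrableOn _) ((D.integrableOn _).const_mul _)
    D.isOpen.measurableSet fun y hy => ?_
  have h1 : (c : (Fin d → ℝ) → ℝ) y ^ 2 ≤ C ^ 2 := sq_le_sq' (abs_le.1 (h y hy)).1 (abs_le.1 (h y hy)).2
  have h2 := mul_le_mul_of_nonneg_right h1 (sq_nonneg ((f : (Fin d → ℝ) → ℝ) y))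
  simp only [MulMemClass.coe_mul, Pi.mul_apply]
  nlinarith

/-- A smooth function vanishing on the boundary is bounded near a boundary point by a multiple of
the defining function. -/
lemma exists_le_rho_of_mem_frontier (h : Sm (Fin d → ℝ))
    (hh : ∀ y ∈ frontier D.carrier, (h : (Fin d → ℝ) → ℝ) y = 0)
    {y : Fin d → ℝ} (hy : y ∈ frontier D.carrier) :
    ∃ C : ℝ, ∀ᶠ x in 𝓝 y, x ∈ D.carrier →
      |(h : (Fin d → ℝ) → ℝ) x| ≤ C * |(D.rho : (Fin d → ℝ) → ℝ) x| := by
  obtain ⟨e, he⟩ : ∃ e, 0 < fderiv ℝ D.defFun y e := by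
    obtain ⟨e, he⟩ : ∃ e, fderiv ℝ D.defFun y e ≠ 0 := by
      by_contra! hcon
      exact D.grad_ne y hy (ContinuousLinearMap.ext hcon)
    rcases lt_or_gt_of_ne he with h0 | h0
    · exact ⟨-e, by simpa using h0⟩
    · exact ⟨e, h0⟩
  set c := fderiv ℝ D.defFun y e / 2 with hc
  have hc0 : 0 < c := by positivity
  obtain ⟨K, s, hs, hK⟩ := (h.contDiff.contDiffAt (x := y)).of_le
    (m := 1) (by simp) |>.exists_lipschitzOnWith
  have hev : ∀ᶠ x in 𝓝 y, x ∈ s ∧ c < fderiv ℝ D.defFun x e :=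
    (show ∀ᶠ x in 𝓝 y, x ∈ s from hs).and
      ((Sm.dd e D.rho).continuous.continuousAt.eventually_const_lt (by
        rw [Sm.dd_apply]; change c < fderiv ℝ D.defFun y e; linarith))
  obtain ⟨r, hr, hball⟩ := Metric.eventually_nhds_iff_ball.1 hev
  have hsmall : ∀ᶠ x in 𝓝 y, |D.defFun x| / c * ‖e‖ < r / 2 := by
    have hcont : ContinuousAt (fun x => |D.defFun x| / c * ‖e‖) y :=
      ((D.defFun_smooth.continuous.abs.div_const c).mul_const ‖e‖).continuousAt
    refine hcont.eventually_lt_const ?_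
    have : D.defFun y = 0 := D.rho_eq_zero_iff.2 hy
    simpa [this] using hr
  refine ⟨K * ‖e‖ / c, ?_⟩
  filter_upwards [hsmall, Metric.ball_mem_nhds y (half_pos hr)] with x hx hxr hxD
  have hneg : D.defFun x < 0 := D.rho_neg_iff.2 hxD
  set S := |D.defFun x| / c with hS
  have hS0 : 0 ≤ S := by positivity
  have hmem : ∀ t ∈ Icc 0 S, x + t • e ∈ Metric.ball y r := by
    intro t ht
    have h1 : ‖t • e‖ ≤ S * ‖e‖ := by
      rw [norm_smul, Real.norm_of_nonneg ht.1]
      exact mul_le_mul_of_nonneg_right ht.2 (norm_nonneg e)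
    rw [Metric.mem_ball, dist_eq_norm] at hxr ⊢
    calc ‖x + t • e - y‖ = ‖(x - y) + t • e‖ := by congr 1; abel
      _ ≤ ‖x - y‖ + ‖t • e‖ := norm_add_le _ _
      _ < r := by linarith
  have hline : ∀ t : ℝ, HasDerivAt (fun t : ℝ => x + t • e) e t := fun t => by
    simpa using ((hasDerivAt_id t).smul_const e).const_add x
  have hder : ∀ t : ℝ, HasDerivAt (fun t : ℝ => D.defFun (x + t • e))
      (fderiv ℝ D.defFun (x + t • e) e) t := fun t =>
    ((D.rho.differentiable (x + t • e)).hasFDerivAt).comp_hasDerivAt t (hline t)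
  have hgrow : c * (S - 0) ≤ D.defFun (x + S • e) - D.defFun (x + (0 : ℝ) • e) := by
    refine (convex_Icc 0 S).mul_sub_le_image_sub_of_le_deriv
      (f := fun t : ℝ => D.defFun (x + t • e))
      (fun t _ => (hder t).continuousAt.continuousWithinAt)
      (fun t _ => (hder t).differentiableAt.differentiableWithinAt) (fun t ht => ?_)
      0 (left_mem_Icc.2 hS0) S (right_mem_Icc.2 hS0) hS0
    rw [(hder t).deriv]
    exact (hball _ (hmem t (interior_subset ht))).2.le
  have hend : 0 ≤ D.defFun (x + S • e) := by
    have h1 : c * S = |D.defFun x| := by rw [hS]; field_simp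
    rw [abs_of_neg hneg] at h1
    simp only [zero_smul, add_zero, sub_zero] at hgrow
    linarith
  obtain ⟨t, ht, ht0⟩ := intermediate_value_Icc hS0
    (f := fun t : ℝ => D.defFun (x + t • e))
    (fun t _ => (hder t).continuousAt.continuousWithinAt)
    (show (0 : ℝ) ∈ Icc _ _ from ⟨by simpa using hneg.le, hend⟩)
  have hp : (h : (Fin d → ℝ) → ℝ) (x + t • e) = 0 := hh _ (D.rho_eq_zero_iff.1 ht0)
  have hxmem : x ∈ s := by
    have := (hball _ (hmem 0 (left_mem_Icc.2 hS0))).1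
    simpa using this
  have hlip := hK.dist_le_mul x hxmem (x + t • e) (hball _ (hmem t ht)).1
  rw [hp, Real.dist_eq, sub_zero, dist_self_add_right, norm_smul,
    Real.norm_of_nonneg ht.1] at hlip
  refine hlip.trans ?_
  calc (K : ℝ) * (t * ‖e‖) ≤ K * (S * ‖e‖) := by gcongr; exact ht.2
    _ = K * ‖e‖ / c * |D.defFun x| := by rw [hS]; ring

/-- A smooth function vanishing on the boundary is bounded in the domain by a multiple of the
defining function. -/
lemma exists_le_rho (h : Sm (Fin d → ℝ))
    (hh : ∀ y ∈ frontier D.carrier, (h : (Fin d → ℝ) → ℝ) y = 0) :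
    ∃ C : ℝ, 0 ≤ C ∧ ∀ y ∈ D.carrier,
      |(h : (Fin d → ℝ) → ℝ) y| ≤ C * |(D.rho : (Fin d → ℝ) → ℝ) y| := by
  suffices ∃ C : ℝ, 0 ≤ C ∧ ∀ y ∈ closure D.carrier, y ∈ D.carrier →
      |(h : (Fin d → ℝ) → ℝ) y| ≤ C * |(D.rho : (Fin d → ℝ) → ℝ) y| by
    obtain ⟨C, hC, h⟩ := this
    exact ⟨C, hC, fun y hy => h y (subset_closure hy) hy⟩
  refine D.isCompact_closure.induction_on
    (p := fun s => ∃ C : ℝ, 0 ≤ C ∧ ∀ y ∈ s, y ∈ D.carrier →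
      |(h : (Fin d → ℝ) → ℝ) y| ≤ C * |(D.rho : (Fin d → ℝ) → ℝ) y|)
    ⟨0, le_rfl, by simp⟩ ?_ ?_ ?_
  · rintro s t hst ⟨C, hC, ht⟩
    exact ⟨C, hC, fun y hy => ht y (hst hy)⟩
  · rintro s t ⟨C, hC, hs⟩ ⟨C', hC', ht⟩
    refine ⟨max C C', le_max_of_le_left hC, ?_⟩
    rintro y (hy | hy) hyD
    · exact (hs y hy hyD).trans (by gcongr; exact le_max_left _ _)
    · exact (ht y hy hyD).trans (by gcongr; exact le_max_right _ _)
  · intro y hy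
    by_cases hyD : y ∈ D.carrier
    · have hlt := D.rho_neg_iff.2 hyD
      have hpos : 0 < |(D.rho : (Fin d → ℝ) → ℝ) y| := abs_pos.2 hlt.ne
      refine ⟨_, mem_nhdsWithin_of_mem_nhds (inter_mem
        (h.continuous.abs.continuousAt.eventually_lt_const
          (lt_add_one |(h : (Fin d → ℝ) → ℝ) y|))
        (D.rho.continuous.abs.continuousAt.eventually_const_lt (half_lt_self hpos))),
        (|(h : (Fin d → ℝ) → ℝ) y| + 1) / (|(D.rho : (Fin d → ℝ) → ℝ) y| / 2),
        by positivity, ?_⟩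
      rintro x ⟨hx1, hx2⟩ -
      simp only [mem_ofPred_eq] at hx1 hx2
      rw [div_mul_eq_mul_div, le_div_iff₀ (by positivity)]
      gcongr
    · have hyf : y ∈ frontier D.carrier := by
        rw [frontier, D.isOpen.interior_eq]
        exact ⟨hy, hyD⟩
      obtain ⟨C, hC⟩ := D.exists_le_rho_of_mem_frontier h hh hyf
      refine ⟨_, mem_nhdsWithin_of_mem_nhds hC, max C 0, le_max_right _ _, fun x hx hxD => ?_⟩
      exact (hx hxD).trans (by gcongr; exact le_max_left _ _)

end SmoothDomain

lemma Real.deriv_smoothTransition_of_neg {t : ℝ} (ht : t < 0) :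
    deriv Real.smoothTransition t = 0 := by
  have h : Real.smoothTransition =ᶠ[𝓝 t] fun _ => (0 : ℝ) := by
    filter_upwards [Iio_mem_nhds ht] with s hs
    exact Real.smoothTransition.zero_of_nonpos (le_of_lt hs)
  rw [h.deriv_eq, deriv_const]

lemma Real.deriv_smoothTransition_of_one_lt {t : ℝ} (ht : 1 < t) :
    deriv Real.smoothTransition t = 0 := by
  have h : Real.smoothTransition =ᶠ[𝓝 t] fun _ => (1 : ℝ) := by
    filter_upwards [Ioi_mem_nhds ht] with s hs
    exact Real.smoothTransition.one_of_one_le (le_of_lt hs)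
  rw [h.deriv_eq, deriv_const]

lemma Real.exists_deriv_smoothTransition_le :
    ∃ K : ℝ, 0 ≤ K ∧ ∀ t, |deriv Real.smoothTransition t| ≤ K := by
  have hcont : Continuous (deriv Real.smoothTransition) :=
    (Real.smoothTransition.contDiff (n := 1)).continuous_deriv (by simp)
  obtain ⟨K, hK⟩ := (isCompact_Icc (a := (0 : ℝ)) (b := 1)).exists_bound_of_continuousOn
    hcont.continuousOn
  refine ⟨max K 0, le_max_right _ _, fun t => ?_⟩
  rcases lt_or_ge t 0 with h0 | h0
  · simp [Real.deriv_smoothTransition_of_neg h0]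
  rcases lt_or_ge 1 t with h1 | h1
  · simp [Real.deriv_smoothTransition_of_one_lt h1]
  exact (hK t ⟨h0, h1⟩).trans (le_max_left _ _)

namespace Sm

/-- The partial derivative in the `i`-th coordinate direction. -/
abbrev der {d : ℕ} (i : Fin d) : Sm (Fin d → ℝ) →ₗ[ℝ] Sm (Fin d → ℝ) := dd (Pi.single i 1)

lemma integral_mul_der_eq_neg {d : ℕ} (i : Fin d) (η f : Sm (Fin d → ℝ))
    (hη : HasCompactSupport (η : (Fin d → ℝ) → ℝ)) :
    ∫ y, ((η * der i f : Sm (Fin d → ℝ)) : (Fin d → ℝ) → ℝ) y =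
      -∫ y, ((der i η * f : Sm (Fin d → ℝ)) : (Fin d → ℝ) → ℝ) y := by
  have hη' : HasCompactSupport (der i η : (Fin d → ℝ) → ℝ) :=
    hη.fderiv_apply (𝕜 := ℝ) (Pi.single i 1)
  refine integral_mul_fderiv_eq_neg_fderiv_mul_of_integrable
    (f := (η : (Fin d → ℝ) → ℝ)) (g := (f : (Fin d → ℝ) → ℝ)) ?_ ?_ ?_ ?_ ?_
  · exact (der i η * f).continuous.integrable_of_hasCompactSupport hη'.mul_right
  · exact (η * der i f).continuous.integrable_of_hasCompactSupport hη.mul_right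
  · exact (η * f).continuous.integrable_of_hasCompactSupport hη.mul_right
  · exact fun x _ => η.differentiable x
  · exact fun x _ => f.differentiable x

end Sm

namespace SmoothDomain

open Sm

variable {d : ℕ} (D : SmoothDomain d)

/-- A smooth cutoff supported in the domain, equal to `1` where `ρ ≤ -2/n`. -/
def cut (n : ℕ) : Sm (Fin d → ℝ) :=
  ⟨fun y => Real.smoothTransition (-n * (D.rho : (Fin d → ℝ) → ℝ) y - 1),
    Real.smoothTransition.contDiff.comp
      ((contDiff_const.mul D.rho.contDiff).sub contDiff_const)⟩

lemma cut_apply (n : ℕ) (y : Fin d → ℝ) : (D.cut n : (Fin d → ℝ) → ℝ) y =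
    Real.smoothTransition (-n * (D.rho : (Fin d → ℝ) → ℝ) y - 1) := rfl

lemma der_cut_apply (n : ℕ) (i : Fin d) (y : Fin d → ℝ) :
    (der i (D.cut n) : (Fin d → ℝ) → ℝ) y =
      deriv Real.smoothTransition (-n * (D.rho : (Fin d → ℝ) → ℝ) y - 1) *
        (-n * (der i D.rho : (Fin d → ℝ) → ℝ) y) := by
  have h1 : HasFDerivAt (fun y => -(n : ℝ) * (D.rho : (Fin d → ℝ) → ℝ) y - 1)
      (-(n : ℝ) • fderiv ℝ (D.rho : (Fin d → ℝ) → ℝ) y) y :=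
    ((D.rho.differentiable y).hasFDerivAt.const_mul (-(n : ℝ))).sub_const 1
  have h2 := ((Real.smoothTransition.contDiff (n := 1)).differentiable (by simp)
    (-(n : ℝ) * (D.rho : (Fin d → ℝ) → ℝ) y - 1)).hasDerivAt.comp_hasFDerivAt y h1
  change fderiv ℝ (Real.smoothTransition ∘ fun y => -(n : ℝ) * (D.rho : (Fin d → ℝ) → ℝ) y - 1) y
    (Pi.single i 1) = _
  rw [h2.fderiv]
  simp [dd_apply]

lemma cut_arg_neg (n : ℕ) {y : Fin d → ℝ} (hy : y ∉ D.carrier) :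
    -n * (D.rho : (Fin d → ℝ) → ℝ) y - 1 < 0 := by
  have h : 0 ≤ (D.rho : (Fin d → ℝ) → ℝ) y := not_lt.1 fun h => hy (D.rho_neg_iff.1 h)
  have : 0 ≤ (n : ℝ) * (D.rho : (Fin d → ℝ) → ℝ) y := by positivity
  linarith

lemma cut_eq_zero (n : ℕ) {y : Fin d → ℝ} (hy : y ∉ D.carrier) :
    (D.cut n : (Fin d → ℝ) → ℝ) y = 0 :=
  Real.smoothTransition.zero_of_nonpos (D.cut_arg_neg n hy).le

lemma der_cut_eq_zero (n : ℕ) (i : Fin d) {y : Fin d → ℝ} (hy : y ∉ D.carrier) :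
    (der i (D.cut n) : (Fin d → ℝ) → ℝ) y = 0 := by
  rw [der_cut_apply, Real.deriv_smoothTransition_of_neg (D.cut_arg_neg n hy), zero_mul]

lemma hasCompactSupport_cut (n : ℕ) : HasCompactSupport (D.cut n : (Fin d → ℝ) → ℝ) :=
  HasCompactSupport.of_support_subset_isCompact D.isCompact_closure fun _ hy =>
    subset_closure (by_contra fun h => hy (D.cut_eq_zero n h))

lemma eventually_one_lt_cut_arg {y : Fin d → ℝ} (hy : y ∈ D.carrier) :
    ∀ᶠ n : ℕ in atTop, 1 < -n * (D.rho : (Fin d → ℝ) → ℝ) y - 1 := by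
  have h := D.rho_neg_iff.2 hy
  have ht : Tendsto (fun n : ℕ => (n : ℝ) * -(D.rho : (Fin d → ℝ) → ℝ) y) atTop atTop :=
    tendsto_natCast_atTop_atTop.atTop_mul_const (by linarith)
  filter_upwards [ht.eventually_gt_atTop 2] with n hn
  linarith

lemma setIntegral_cut_mul_der (n : ℕ) (i : Fin d) (f : Sm (Fin d → ℝ)) :
    D.ip (D.cut n) (der i f) = -D.ip (der i (D.cut n)) f := by
  have h := integral_mul_der_eq_neg i (D.cut n) f (D.hasCompactSupport_cut n)
  rw [ip_apply, ip_apply, setIntegral_eq_integral_of_forall_compl_eq_zero,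
    setIntegral_eq_integral_of_forall_compl_eq_zero, h]
  · intro y hy
    simp [D.der_cut_eq_zero n i hy]
  · intro y hy
    simp [D.cut_eq_zero n hy]

lemma tendsto_ip_cut (f : Sm (Fin d → ℝ)) :
    Tendsto (fun n => D.ip (D.cut n) f) atTop
      (𝓝 (∫ y in D.carrier, (f : (Fin d → ℝ) → ℝ) y)) := by
  refine tendsto_integral_of_dominated_convergence (fun y => |(f : (Fin d → ℝ) → ℝ) y|)
    (fun n => (D.cut n * f).continuous.aestronglyMeasurable) (D.integrableOn f).abs
    (fun n => ae_of_all _ fun y => ?_) ?_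
  · simp only [MulMemClass.coe_mul, Pi.mul_apply, norm_mul, Real.norm_eq_abs, cut_apply,
      abs_of_nonneg (Real.smoothTransition.nonneg _)]
    exact mul_le_of_le_one_left (abs_nonneg _) (Real.smoothTransition.le_one _)
  · filter_upwards [ae_restrict_mem D.isOpen.measurableSet] with y hy
    refine tendsto_const_nhds.congr' ?_
    filter_upwards [D.eventually_one_lt_cut_arg hy] with n hn
    rw [MulMemClass.coe_mul, Pi.mul_apply, cut_apply,
      Real.smoothTransition.one_of_one_le hn.le, one_mul]

/-- A vector field is tangential if it is tangent to the boundary at all boundary points. -/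
def Tangential (b : Fin d → Sm (Fin d → ℝ)) : Prop :=
  ∀ y ∈ frontier D.carrier, ((∑ i, b i * der i D.rho : Sm (Fin d → ℝ)) : (Fin d → ℝ) → ℝ) y = 0

lemma tendsto_ip_der_cut {F : Fin d → Sm (Fin d → ℝ)} (hF : D.Tangential F) :
    Tendsto (fun n => ∑ i, D.ip (der i (D.cut n)) (F i)) atTop (𝓝 0) := by
  obtain ⟨C, hC, hCh⟩ := D.exists_le_rho _ hF
  obtain ⟨K, hK, hKt⟩ := Real.exists_deriv_smoothTransition_le
  set h : Sm (Fin d → ℝ) := ∑ i, F i * der i D.rho with hh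
  have hsum : ∀ n y, ((∑ i, der i (D.cut n) * F i : Sm (Fin d → ℝ)) : (Fin d → ℝ) → ℝ) y =
      deriv Real.smoothTransition (-n * (D.rho : (Fin d → ℝ) → ℝ) y - 1) *
        (-n * (h : (Fin d → ℝ) → ℝ) y) := by
    intro n y
    rw [hh, coe_sum, coe_sum, Finset.mul_sum, Finset.mul_sum]
    refine Finset.sum_congr rfl fun i _ => ?_
    simp only [MulMemClass.coe_mul, Pi.mul_apply, der_cut_apply]
    ring
  have heq : ∀ n, ∑ i, D.ip (der i (D.cut n)) (F i) =
      ∫ y in D.carrier, ((∑ i, der i (D.cut n) * F i : Sm (Fin d → ℝ)) : (Fin d → ℝ) → ℝ) y := by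
    intro n
    simp only [ip_apply, coe_sum]
    rw [integral_finsetSum _ fun i _ => D.integrableOn _]
  simp only [heq]
  rw [show (0 : ℝ) = ∫ _ in D.carrier, (0 : ℝ) by simp]
  refine tendsto_integral_of_dominated_convergence (fun _ => 2 * K * C)
    (fun n => (Sm.continuous _).aestronglyMeasurable) (integrable_const _) (fun n => ?_) ?_
  · filter_upwards [ae_restrict_mem D.isOpen.measurableSet] with y hy
    rw [hsum, Real.norm_eq_abs]
    have hr := D.rho_neg_iff.2 hy
    rcases lt_or_ge 1 (-n * (D.rho : (Fin d → ℝ) → ℝ) y - 1) with h1 | h1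
    · rw [Real.deriv_smoothTransition_of_one_lt h1, zero_mul, abs_zero]
      positivity
    · rw [abs_mul, abs_mul, abs_neg, Nat.abs_cast]
      have h2 : n * |(h : (Fin d → ℝ) → ℝ) y| ≤ 2 * C := by
        calc n * |(h : (Fin d → ℝ) → ℝ) y| ≤ n * (C * |(D.rho : (Fin d → ℝ) → ℝ) y|) := by
              gcongr; exact hCh y hy
          _ = (-n * (D.rho : (Fin d → ℝ) → ℝ) y) * C := by rw [abs_of_neg hr]; ring
          _ ≤ 2 * C := by gcongr; linarith
      calc _ ≤ K * (2 * C) := mul_le_mul (hKt _) h2 (by positivity) hK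
        _ = 2 * K * C := by ring
  · filter_upwards [ae_restrict_mem D.isOpen.measurableSet] with y hy
    refine tendsto_const_nhds.congr' ?_
    filter_upwards [D.eventually_one_lt_cut_arg hy] with n hn
    rw [hsum, Real.deriv_smoothTransition_of_one_lt hn, zero_mul]

/-- Divergence theorem for tangential vector fields. -/
theorem integral_div_eq_zero {F : Fin d → Sm (Fin d → ℝ)} (hF : D.Tangential F) :
    ∫ y in D.carrier, ((∑ i, der i (F i) : Sm (Fin d → ℝ)) : (Fin d → ℝ) → ℝ) y = 0 := by
  have h1 := D.tendsto_ip_cut (∑ i, der i (F i))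
  have h2 := (D.tendsto_ip_der_cut hF).neg
  simp only [map_sum, D.setIntegral_cut_mul_der, Finset.sum_neg_distrib] at h1
  simpa using tendsto_nhds_unique h1 h2

end SmoothDomain

namespace Sm

variable {d : ℕ}

/-- The first-order operator `∑ bⱼ ∂ⱼ`. -/
def vf (b : Fin d → Sm (Fin d → ℝ)) : Sm (Fin d → ℝ) →ₗ[ℝ] Sm (Fin d → ℝ) where
  toFun v := ∑ j, b j * der j v
  map_add' v w := by simp [mul_add, Finset.sum_add_distrib]
  map_smul' c v := by simp [Finset.smul_sum]

lemma vf_apply (b : Fin d → Sm (Fin d → ℝ)) (v : Sm (Fin d → ℝ)) :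
    vf b v = ∑ j, b j * der j v := rfl

lemma vf_single (j : Fin d) (a v : Sm (Fin d → ℝ)) : vf (Pi.single j a) v = a * der j v := by
  rw [vf_apply, Finset.sum_eq_single j]
  · simp
  · intro i _ hi
    simp [hi]
  · simp

lemma vf_sub_left (b c : Fin d → Sm (Fin d → ℝ)) (v : Sm (Fin d → ℝ)) :
    vf (b - c) v = vf b v - vf c v := by
  simp [vf_apply, sub_mul]

/-- The divergence of a vector field. -/
def dv (b : Fin d → Sm (Fin d → ℝ)) : Sm (Fin d → ℝ) := ∑ j, der j (b j)

/-- The Laplacian. -/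
def lap : Sm (Fin d → ℝ) →ₗ[ℝ] Sm (Fin d → ℝ) := ∑ j, (der j).comp (der j)

lemma lap_apply (v : Sm (Fin d → ℝ)) : lap v = ∑ j, der j (der j v) := by
  simp [lap]

lemma vf_mul (b : Fin d → Sm (Fin d → ℝ)) (f g : Sm (Fin d → ℝ)) :
    vf b (f * g) = vf b f * g + f * vf b g := by
  simp only [vf_apply, dd_mul, Finset.sum_mul, Finset.mul_sum, ← Finset.sum_add_distrib]
  exact Finset.sum_congr rfl fun _ _ => by ring

lemma der_vf (b : Fin d → Sm (Fin d → ℝ)) (i : Fin d) (v : Sm (Fin d → ℝ)) :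
    der i (vf b v) = vf b (der i v) + vf (fun j => der i (b j)) v := by
  simp only [vf_apply, map_sum, dd_mul, ← Finset.sum_add_distrib]
  refine Finset.sum_congr rfl fun j _ => ?_
  rw [dd_comm (Pi.single i 1) (Pi.single j 1) v]
  ring

end Sm

namespace SmoothDomain

open Sm

variable {d : ℕ} (D : SmoothDomain d)

/-- Test functions: if `p` holds, they have to vanish on the boundary. -/
def Test (p : Prop) (φ : Sm (Fin d → ℝ)) : Prop :=
  p → ∀ y ∈ frontier D.carrier, (φ : (Fin d → ℝ) → ℝ) y = 0

/-- The boundary condition: Dirichlet if `p` holds and Neumann otherwise. -/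
def BC (p : Prop) (v : Sm (Fin d → ℝ)) : Prop :=
  D.Test p v ∧ (¬p → D.Tangential fun i => der i v)

/-- The weak form of `-Δv = f - ∑ ∂ᵢ gᵢ` with the boundary condition encoded by `p`. -/
def Weak (p : Prop) (v f : Sm (Fin d → ℝ)) (g : Fin d → Sm (Fin d → ℝ)) : Prop :=
  ∀ φ, D.Test p φ → ∑ i, D.ip (der i v) (der i φ) = D.ip f φ + ∑ i, D.ip (g i) (der i φ)

variable {D}

lemma Tangential.mul_left {b : Fin d → Sm (Fin d → ℝ)} (hb : D.Tangential b)
    (c : Sm (Fin d → ℝ)) : D.Tangential fun i => c * b i := by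
  intro y hy
  have h := hb y hy
  simp only [mul_assoc, ← Finset.mul_sum, MulMemClass.coe_mul, Pi.mul_apply, h, mul_zero]

lemma Tangential.ip_vf {b : Fin d → Sm (Fin d → ℝ)} (hb : D.Tangential b)
    (f g : Sm (Fin d → ℝ)) : D.ip (vf b f) g = -D.ip f (vf b g + dv b * g) := by
  have h := D.integral_div_eq_zero (hb.mul_left (f * g))
  have h2 : ∑ i, der i (f * g * b i) = vf b f * g + f * (vf b g + dv b * g) := by
    have h3 : ∑ i, der i (f * g * b i) = vf b (f * g) + f * g * dv b := by
      simp only [vf_apply, dv, Finset.mul_sum, ← Finset.sum_add_distrib, dd_mul]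
      exact Finset.sum_congr rfl fun _ _ => by ring
    rw [h3, vf_mul]
    ring
  rw [h2] at h
  have h4 := integral_add (D.integrableOn (vf b f * g)) (D.integrableOn (f * (vf b g + dv b * g)))
  rw [ip_apply, ip_apply]
  simp only [AddMemClass.coe_add, Pi.add_apply] at h h4 ⊢
  linarith

lemma Test.mul_left {p : Prop} {φ : Sm (Fin d → ℝ)} (hφ : D.Test p φ) (c : Sm (Fin d → ℝ)) :
    D.Test p (c * φ) := fun hp y hy => by
  simp [hφ hp y hy]

lemma Test.add {p : Prop} {φ ψ : Sm (Fin d → ℝ)} (hφ : D.Test p φ) (hψ : D.Test p ψ) :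
    D.Test p (φ + ψ) := fun hp y hy => by
  simp [hφ hp y hy, hψ hp y hy]

/-- Tangential derivatives preserve functions vanishing on the boundary. -/
lemma Test.vf {p : Prop} {φ : Sm (Fin d → ℝ)} (hφ : D.Test p φ)
    {b : Fin d → Sm (Fin d → ℝ)} (hb : D.Tangential b) : D.Test p (vf b φ) := by
  intro hp y hy
  have hy0 := D.rho_eq_zero_iff.2 hy
  have hext : IsLocalExtrOn (φ : (Fin d → ℝ) → ℝ)
      {x | (D.rho : (Fin d → ℝ) → ℝ) x = (D.rho : (Fin d → ℝ) → ℝ) y} y := by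
    left
    filter_upwards [self_mem_nhdsWithin] with x hx
    have hx' : (D.rho : (Fin d → ℝ) → ℝ) x = 0 := hx.trans hy0
    rw [hφ hp y hy, hφ hp x (D.rho_eq_zero_iff.1 hx')]
  obtain ⟨α, β, hne, hlin⟩ := hext.exists_multipliers_of_hasStrictFDerivAt_1d
    (D.rho.contDiff.contDiffAt.hasStrictFDerivAt (by simp))
    (φ.contDiff.contDiffAt.hasStrictFDerivAt (by simp))
  have hβ : β ≠ 0 := by
    rintro rfl
    have hα : α ≠ 0 := fun h => hne (by rw [h]; rfl)
    rw [zero_smul, add_zero] at hlin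
    exact D.grad_ne y hy ((smul_eq_zero.1 hlin).resolve_left hα)
  have hb' := hb y hy
  rw [vf_apply]
  simp only [coe_sum, MulMemClass.coe_mul, Pi.mul_apply] at hb' ⊢
  have hj : ∀ j, α * (der j D.rho : (Fin d → ℝ) → ℝ) y + β * (der j φ : (Fin d → ℝ) → ℝ) y = 0 :=
    fun j => by simpa [dd_apply] using congrArg (fun l => l (Pi.single j 1)) hlin
  have : β * ∑ j, (b j : (Fin d → ℝ) → ℝ) y * (der j φ : (Fin d → ℝ) → ℝ) y =
      -α * ∑ j, (b j : (Fin d → ℝ) → ℝ) y * (der j D.rho : (Fin d → ℝ) → ℝ) y := by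
    rw [Finset.mul_sum, Finset.mul_sum]
    refine Finset.sum_congr rfl fun j _ => ?_
    linear_combination (b j : (Fin d → ℝ) → ℝ) y * hj j
  rw [hb', mul_zero] at this
  exact (mul_eq_zero.1 this).resolve_left hβ

lemma BC.weak {p : Prop} {v : Sm (Fin d → ℝ)} (hv : D.BC p v) : D.Weak p v (-lap v) 0 := by
  intro φ hφ
  have ht : D.Tangential fun i => φ * der i v := by
    by_cases hp : p
    · intro y hy
      simp [hφ hp y hy]
    · exact (hv.2 hp).mul_left φ
  have h := D.integral_div_eq_zero ht
  have h2 : ∑ i, der i (φ * der i v) = ∑ i, der i v * der i φ + lap v * φ := by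
    simp only [lap_apply, Finset.sum_mul, ← Finset.sum_add_distrib, dd_mul]
    exact Finset.sum_congr rfl fun _ _ => by ring
  have h3 := integral_add (D.integrableOn (∑ i, der i v * der i φ)) (D.integrableOn (lap v * φ))
  have h4 := integral_finsetSum (μ := volume.restrict D.carrier) (Finset.univ : Finset (Fin d))
    fun i _ => D.integrableOn (der i v * der i φ)
  rw [h2] at h
  simp only [map_neg, LinearMap.neg_apply, Pi.zero_apply, map_zero, LinearMap.zero_apply,
    Finset.sum_const_zero, add_zero, ip_apply]
  simp only [AddMemClass.coe_add, Pi.add_apply, coe_sum] at h h3 h4 ⊢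
  linarith

/-- The right hand sides of the weak problem solved by `∑ bⱼ ∂ⱼ v`. -/
def weakStep (b : Fin d → Sm (Fin d → ℝ)) (v : Sm (Fin d → ℝ))
    (F : Sm (Fin d → ℝ) × (Fin d → Sm (Fin d → ℝ))) :
    Sm (Fin d → ℝ) × (Fin d → Sm (Fin d → ℝ)) :=
  (∑ i, der i (dv b) * (der i v - F.2 i) - dv b * F.1,
    fun j => Sm.vf b (F.2 j) - b j * F.1 + ∑ i, der i (b j) * (der i v - F.2 i) +
      Sm.vf (fun i => der j (b i)) v)

lemma Weak.vf {p : Prop} {v : Sm (Fin d → ℝ)} {F : Sm (Fin d → ℝ) × (Fin d → Sm (Fin d → ℝ))}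
    (hw : D.Weak p v F.1 F.2) {b : Fin d → Sm (Fin d → ℝ)} (hb : D.Tangential b) :
    D.Weak p (vf b v) (weakStep b v F).1 (weakStep b v F).2 := by
  intro φ hφ
  obtain ⟨f, g⟩ := F
  have h := hw (Sm.vf b φ + dv b * φ) ((hφ.vf hb).add (hφ.mul_left _))
  have key : ∀ i a, D.ip a (der i (Sm.vf b φ + dv b * φ)) =
      -D.ip (Sm.vf b a) (der i φ) + ∑ j, D.ip (der i (b j) * a) (der j φ) +
        D.ip (der i (dv b) * a) φ := by
    intro i a
    rw [hb.ip_vf, neg_neg]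
    simp only [D.ip_mul_left]
    rw [← map_sum, ← map_add, ← map_add]
    congr 1
    rw [map_add, der_vf, dd_mul, vf_apply (fun j => der i (b j))]
    ring
  have hf : D.ip f (Sm.vf b φ + dv b * φ) =
      ∑ j, D.ip (b j * f) (der j φ) + D.ip (dv b * f) φ := by
    simp only [D.ip_mul_left, vf_apply, map_add, map_sum]
  simp only [key, hf, Finset.sum_add_distrib, Finset.sum_neg_distrib] at h
  simp only [weakStep, der_vf, map_add, map_sub, map_sum, mul_sub, LinearMap.add_apply,
    LinearMap.sub_apply, LinearMap.sum_apply, Finset.sum_add_distrib, Finset.sum_sub_distrib]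
  rw [Finset.sum_comm (f := fun i j => D.ip (der i (b j) * der i v) (der j φ)),
    Finset.sum_comm (f := fun i j => D.ip (der i (b j) * g i) (der j φ))] at h
  linarith

lemma Weak.nrm_der_le {p : Prop} {v f : Sm (Fin d → ℝ)} {g : Fin d → Sm (Fin d → ℝ)}
    (hw : D.Weak p v f g) (hv : D.Test p v) (i : Fin d) :
    D.nrm (der i v) ≤ 2 * (D.nrm f + D.nrm v + ∑ j, D.nrm (g j)) := by
  have h := hw v hv
  simp only [← nrm_sq] at h
  have h1 : ∑ j, D.ip (g j) (der j v) ≤ ∑ j, (D.nrm (g j) ^ 2 / 2 + D.nrm (der j v) ^ 2 / 2) :=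
    Finset.sum_le_sum fun j _ => (D.ip_le _ _).trans (by
      nlinarith [sq_nonneg (D.nrm (g j) - D.nrm (der j v))])
  rw [Finset.sum_add_distrib, ← Finset.sum_div, ← Finset.sum_div] at h1
  have h2 : ∑ j, D.nrm (g j) ^ 2 ≤ (∑ j, D.nrm (g j)) ^ 2 :=
    Finset.sum_sq_le_sq_sum_of_nonneg fun j _ => D.nrm_nonneg _
  have h3 : D.nrm (der i v) ^ 2 ≤ ∑ j, D.nrm (der j v) ^ 2 :=
    Finset.single_le_sum (f := fun j => D.nrm (der j v) ^ 2) (fun j _ => sq_nonneg _)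
      (Finset.mem_univ i)
  have h4 := D.ip_le f v
  have hf := D.nrm_nonneg f
  have hv := D.nrm_nonneg v
  have hg : 0 ≤ ∑ j, D.nrm (g j) := Finset.sum_nonneg fun j _ => D.nrm_nonneg _
  refine abs_le_of_sq_le_sq' ?_ (by positivity) |>.2
  nlinarith [mul_nonneg hf hv, mul_nonneg hf hg, mul_nonneg hv hg]

end SmoothDomain

namespace SmoothDomain

open Sm

variable {d : ℕ} (D : SmoothDomain d)

/-- The Sobolev norm of order `n` on `Ω`, as a sum of `L²` norms of derivatives. -/
def H : ℕ → Sm (Fin d → ℝ) → ℝ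
  | 0, v => D.nrm v
  | n + 1, v => H n v + ∑ i, H n (der i v)

lemma H_nonneg (n : ℕ) (v : Sm (Fin d → ℝ)) : 0 ≤ D.H n v := by
  induction n generalizing v with
  | zero => exact D.nrm_nonneg v
  | succ n ih => exact add_nonneg (ih v) (Finset.sum_nonneg fun i _ => ih _)

lemma H_le_succ (n : ℕ) (v : Sm (Fin d → ℝ)) : D.H n v ≤ D.H (n + 1) v :=
  le_add_of_nonneg_right (Finset.sum_nonneg fun _ _ => D.H_nonneg n _)

lemma H_mono {m n : ℕ} (h : m ≤ n) (v : Sm (Fin d → ℝ)) : D.H m v ≤ D.H n v :=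
  monotone_nat_of_le_succ (f := fun n => D.H n v) (fun n => D.H_le_succ n v) h

lemma H_der_le (n : ℕ) (i : Fin d) (v : Sm (Fin d → ℝ)) : D.H n (der i v) ≤ D.H (n + 1) v :=
  (Finset.single_le_sum (f := fun i => D.H n (der i v)) (fun _ _ => D.H_nonneg n _)
    (Finset.mem_univ i)).trans (le_add_of_nonneg_left (D.H_nonneg n v))

lemma H_add_le (n : ℕ) (v w : Sm (Fin d → ℝ)) : D.H n (v + w) ≤ D.H n v + D.H n w := by
  induction n generalizing v w with
  | zero => exact D.nrm_add_le v w
  | succ n ih =>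
    have h : ∑ i, D.H n (der i (v + w)) ≤ ∑ i, (D.H n (der i v) + D.H n (der i w)) :=
      Finset.sum_le_sum fun i _ => by rw [map_add]; exact ih _ _
    rw [Finset.sum_add_distrib] at h
    simp only [H]
    linarith [ih v w]

lemma H_neg (n : ℕ) (v : Sm (Fin d → ℝ)) : D.H n (-v) = D.H n v := by
  induction n generalizing v with
  | zero => exact D.nrm_neg v
  | succ n ih => simp only [H, map_neg, ih]

lemma H_zero (n : ℕ) : D.H n 0 = 0 := by
  induction n with
  | zero => exact D.nrm_zero
  | succ n ih => simp [H, ih]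

section Dom

variable {D} {α : Type*} {B : α → ℝ} {n : ℕ} {L M : α → Sm (Fin d → ℝ)}

lemma dom_add (hL : Dom (fun a => D.H n (L a)) B) (hM : Dom (fun a => D.H n (M a)) B) :
    Dom (fun a => D.H n (L a + M a)) B :=
  (hL.add hM).mono_left fun _ => D.H_add_le n _ _

lemma dom_neg (hL : Dom (fun a => D.H n (L a)) B) : Dom (fun a => D.H n (-L a)) B := by
  simpa only [H_neg] using hL

lemma dom_sub (hL : Dom (fun a => D.H n (L a)) B) (hM : Dom (fun a => D.H n (M a)) B) :
    Dom (fun a => D.H n (L a - M a)) B := by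
  simpa only [sub_eq_add_neg] using dom_add hL (dom_neg hM)

lemma dom_zero (hB : ∀ a, 0 ≤ B a) : Dom (fun _ => D.H n 0) B :=
  Dom.of_le fun a => by rw [H_zero]; exact hB a

lemma dom_sum {ι : Type*} {s : Finset ι} {L : ι → α → Sm (Fin d → ℝ)} (hB : ∀ a, 0 ≤ B a)
    (h : ∀ i ∈ s, Dom (fun a => D.H n (L i a)) B) : Dom (fun a => D.H n (∑ i ∈ s, L i a)) B := by
  classical
  induction s using Finset.induction_on with
  | empty => simpa using dom_zero hB
  | insert i s hi ih =>
    simp only [Finset.sum_insert hi]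
    exact dom_add (h i (by simp)) (ih fun j hj => h j (by simp [hj]))

variable (D) in
lemma H_mul_dom (n : ℕ) (c : Sm (Fin d → ℝ)) : Dom (fun v => D.H n (c * v)) (D.H n) := by
  induction n generalizing c with
  | zero => exact D.nrm_mul_le c
  | succ n ih =>
    refine ((ih c).mono_right (D.H_le_succ n)).add (Dom.sum (D.H_nonneg _) fun i _ => ?_)
    simp only [dd_mul]
    exact dom_add ((ih _).mono_right (D.H_le_succ n))
      (((ih c).comp (der i)).mono_right (D.H_der_le n i))

lemma dom_mul (c : Sm (Fin d → ℝ)) (hL : Dom (fun a => D.H n (L a)) B) :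
    Dom (fun a => D.H n (c * L a)) B :=
  ((D.H_mul_dom n c).comp L).trans hL

lemma dom_der (i : Fin d) (hL : Dom (fun a => D.H (n + 1) (L a)) B) :
    Dom (fun a => D.H n (der i (L a))) B :=
  hL.mono_left fun _ => D.H_der_le n i _

lemma dom_of_succ (hL : Dom (fun a => D.H (n + 1) (L a)) B) : Dom (fun a => D.H n (L a)) B :=
  hL.mono_left fun _ => D.H_le_succ n _

lemma dom_vf (b : Fin d → Sm (Fin d → ℝ)) (hL : Dom (fun a => D.H (n + 1) (L a)) B) :
    Dom (fun a => D.H n (vf b (L a))) B := by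
  have h : Dom (fun v => D.H n (vf b v)) (D.H (n + 1)) := by
    simp only [vf_apply]
    exact dom_sum (D.H_nonneg _) fun i _ => dom_mul _ (Dom.of_le (D.H_der_le n i))
  exact (h.comp L).trans hL

end Dom

/-- Iterated application of vector fields. -/
def word : List (Fin d → Sm (Fin d → ℝ)) → Sm (Fin d → ℝ) → Sm (Fin d → ℝ)
  | [], v => v
  | b :: L, v => vf b (word L v)

/-- The right hand sides of the weak problem solved by `word L v`. -/
def weakData : List (Fin d → Sm (Fin d → ℝ)) → Sm (Fin d → ℝ) →
    Sm (Fin d → ℝ) × (Fin d → Sm (Fin d → ℝ))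
  | [], v => (-lap v, 0)
  | b :: L, v => weakStep b (word L v) (weakData L v)

lemma BC.weak_word {D : SmoothDomain d} {p : Prop} {v : Sm (Fin d → ℝ)} (hv : D.BC p v)
    (L : List (Fin d → Sm (Fin d → ℝ))) (hL : ∀ b ∈ L, D.Tangential b) :
    D.Test p (word L v) ∧ D.Weak p (word L v) (weakData L v).1 (weakData L v).2 := by
  induction L with
  | nil => exact ⟨hv.1, hv.weak⟩
  | cons b L ih =>
    obtain ⟨h1, h2⟩ := ih fun c hc => hL c (by simp [hc])
    exact ⟨h1.vf (hL b (by simp)), h2.vf (hL b (by simp))⟩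

/-- The quantity controlling derivatives of order `n + 2`. -/
def Ebd (n : ℕ) (v : Sm (Fin d → ℝ)) : ℝ := D.H n (lap v) + D.H (n + 1) v

lemma Ebd_nonneg (n : ℕ) (v : Sm (Fin d → ℝ)) : 0 ≤ D.Ebd n v :=
  add_nonneg (D.H_nonneg _ _) (D.H_nonneg _ _)

lemma Ebd_mono {m n : ℕ} (h : m ≤ n) (v : Sm (Fin d → ℝ)) : D.Ebd m v ≤ D.Ebd n v :=
  add_le_add (D.H_mono h _) (D.H_mono (by omega) _)

lemma H_le_Ebd {m n : ℕ} (h : m ≤ n + 1) (v : Sm (Fin d → ℝ)) : D.H m v ≤ D.Ebd n v :=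
  (D.H_mono h v).trans (le_add_of_nonneg_left (D.H_nonneg _ _))

lemma H_lap_le_Ebd {m n : ℕ} (h : m ≤ n) (v : Sm (Fin d → ℝ)) : D.H m (lap v) ≤ D.Ebd n v :=
  (D.H_mono h _).trans (le_add_of_nonneg_right (D.H_nonneg _ _))

lemma word_dom (L : List (Fin d → Sm (Fin d → ℝ))) (n : ℕ) :
    Dom (fun v => D.H n (word L v)) (D.H (n + L.length)) := by
  induction L generalizing n with
  | nil => exact Dom.of_le fun _ => le_rfl
  | cons b L ih =>
    refine dom_vf b ((ih (n + 1)).mono_right fun v => D.H_mono ?_ v)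
    simp only [List.length_cons]
    omega

lemma weakStep_dom {α : Type*} {B : α → ℝ} (hB : ∀ a, 0 ≤ B a) (b : Fin d → Sm (Fin d → ℝ))
    (s : ℕ) {w : α → Sm (Fin d → ℝ)} {F : α → Sm (Fin d → ℝ) × (Fin d → Sm (Fin d → ℝ))}
    (hw : Dom (fun a => D.H (s + 1) (w a)) B) (hf : Dom (fun a => D.H s (F a).1) B)
    (hg : ∀ j, Dom (fun a => D.H (s + 1) ((F a).2 j)) B) :
    Dom (fun a => D.H s (weakStep b (w a) (F a)).1) B ∧
      ∀ j, Dom (fun a => D.H s ((weakStep b (w a) (F a)).2 j)) B := by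
  have hq : ∀ i, Dom (fun a => D.H s (der i (w a) - (F a).2 i)) B := fun i =>
    dom_sub (dom_der i hw) (dom_of_succ (hg i))
  refine ⟨?_, fun j => ?_⟩
  · exact dom_sub (dom_sum hB fun i _ => dom_mul _ (hq i)) (dom_mul _ hf)
  · exact dom_add (dom_add (dom_sub (dom_vf b (hg j)) (dom_mul _ hf))
      (dom_sum hB fun i _ => dom_mul _ (hq i))) (dom_vf _ hw)

lemma weakData_dom (L : List (Fin d → Sm (Fin d → ℝ))) (b : Fin d → Sm (Fin d → ℝ)) (s : ℕ) :
    Dom (fun v => D.H s (weakData (b :: L) v).1) (D.Ebd (s + L.length)) ∧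
      ∀ j, Dom (fun v => D.H s ((weakData (b :: L) v).2 j)) (D.Ebd (s + L.length)) := by
  induction L generalizing b s with
  | nil =>
    refine D.weakStep_dom (D.Ebd_nonneg _) b s (F := fun v => weakData [] v)
      (Dom.of_le (D.H_le_Ebd le_rfl)) (dom_neg (Dom.of_le (D.H_lap_le_Ebd le_rfl)))
      fun j => dom_zero (D.Ebd_nonneg _)
  | cons c L ih =>
    have hlen : s + 1 + L.length = s + (c :: L).length := by
      simp only [List.length_cons]
      omega
    refine D.weakStep_dom (D.Ebd_nonneg _) b s (F := fun v => weakData (c :: L) v) ?_ ?_ ?_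
    · exact (D.word_dom (c :: L) (s + 1)).mono_right (D.H_le_Ebd (by omega))
    · exact (ih c s).1.mono_right (D.Ebd_mono (by omega))
    · rw [← hlen]
      exact (ih c (s + 1)).2

/-- Tangential regularity: tangential derivatives of solutions are controlled in `H¹`. -/
lemma word_H_one_dom (p : Prop) (b : Fin d → Sm (Fin d → ℝ)) (L : List (Fin d → Sm (Fin d → ℝ)))
    (hL : ∀ c ∈ b :: L, D.Tangential c) :
    Dom (fun v : {v // D.BC p v} => D.H 1 (word (b :: L) v.1)) (fun v => D.Ebd L.length v.1) := by
  have h0 : Dom (fun v => D.nrm (word (b :: L) v)) (D.Ebd L.length) :=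
    (D.word_dom (b :: L) 0).mono_right (D.H_le_Ebd (by simp))
  obtain ⟨hf, hg⟩ := D.weakData_dom L b 0
  rw [zero_add] at hf hg
  have hsum : Dom (fun v => D.nrm (weakData (b :: L) v).1 + D.nrm (word (b :: L) v) +
      ∑ j, D.nrm ((weakData (b :: L) v).2 j)) (D.Ebd L.length) :=
    (hf.add h0).add (Dom.sum (D.Ebd_nonneg _) fun j _ => hg j)
  refine (h0.comp Subtype.val).add (Dom.sum (fun v => D.Ebd_nonneg _ _) fun i _ => ?_)
  refine Dom.trans ⟨2, by norm_num, fun v => ?_⟩ (hsum.comp Subtype.val)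
  obtain ⟨h1, h2⟩ := v.2.weak_word (b :: L) hL
  exact h2.nrm_der_le h1 i

lemma lap_vf_sub_dom {α : Type*} {B : α → ℝ} (hB : ∀ a, 0 ≤ B a) (b : Fin d → Sm (Fin d → ℝ))
    (n : ℕ) {w : α → Sm (Fin d → ℝ)} (hw : Dom (fun a => D.H (n + 2) (w a)) B) :
    Dom (fun a => D.H n (lap (vf b (w a)) - vf b (lap (w a)))) B := by
  have h : ∀ v, lap (vf b v) - vf b (lap v) =
      ∑ i, (vf (fun j => der i (b j)) (der i v) + der i (vf (fun j => der i (b j)) v)) := by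
    intro v
    simp only [lap_apply, map_sum, ← Finset.sum_sub_distrib]
    refine Finset.sum_congr rfl fun i _ => ?_
    rw [der_vf b i v, map_add, der_vf b i]
    abel
  simp only [h]
  exact dom_sum hB fun i _ => dom_add (dom_vf _ (dom_der i hw)) (dom_der i (dom_vf _ hw))

lemma lap_word_sub_dom (L : List (Fin d → Sm (Fin d → ℝ))) (n : ℕ) :
    Dom (fun v => D.H n (lap (word L v) - word L (lap v))) (D.H (n + L.length + 1)) := by
  induction L generalizing n with
  | nil => simpa [word] using dom_zero (D.H_nonneg _)
  | cons b L ih =>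
    have h : ∀ v, lap (word (b :: L) v) - word (b :: L) (lap v) =
        (lap (vf b (word L v)) - vf b (lap (word L v))) +
          vf b (lap (word L v) - word L (lap v)) := by
      intro v
      rw [map_sub]
      simp only [word]
      abel
    have e : n + 1 + L.length + 1 = n + (b :: L).length + 1 := by
      simp only [List.length_cons]
      omega
    simp only [h]
    refine dom_add (D.lap_vf_sub_dom (D.H_nonneg _) b n ?_) (dom_vf b ?_)
    · exact (D.word_dom L (n + 2)).mono_right (D.H_mono (by omega))
    · rw [← e]
      exact ih (n + 1)

lemma lap_word_dom (L : List (Fin d → Sm (Fin d → ℝ))) (n : ℕ) :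
    Dom (fun v => D.H n (lap (word L v))) (D.Ebd (n + L.length)) := by
  have h1 := (D.lap_word_sub_dom L n).mono_right (D.H_le_Ebd (n := n + L.length) (by omega))
  have h2 := ((D.word_dom L n).comp lap).mono_right (D.H_lap_le_Ebd (n := n + L.length) le_rfl)
  simpa using dom_add h1 h2

/-- A finite family of tangential vector fields spanning all directions in the interior and all
tangential directions on the boundary. -/
def fam : (Fin d × Fin d) ⊕ Fin d → Fin d → Sm (Fin d → ℝ)
  | Sum.inl (i, j) => Pi.single j (der i D.rho) - Pi.single i (der j D.rho)
  | Sum.inr k => Pi.single k D.rho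

lemma vf_fam_inl (i j : Fin d) (v : Sm (Fin d → ℝ)) :
    vf (D.fam (Sum.inl (i, j))) v = der i D.rho * der j v - der j D.rho * der i v := by
  rw [fam, vf_sub_left, vf_single, vf_single]

lemma vf_fam_inr (k : Fin d) (v : Sm (Fin d → ℝ)) :
    vf (D.fam (Sum.inr k)) v = D.rho * der k v := by
  rw [fam, vf_single]

lemma fam_tangential (τ : (Fin d × Fin d) ⊕ Fin d) : D.Tangential (D.fam τ) := by
  intro y hy
  rw [← vf_apply]
  rcases τ with ⟨i, j⟩ | k
  · rw [vf_fam_inl, mul_comm, sub_self]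
    rfl
  · rw [vf_fam_inr]
    simp [D.rho_eq_zero_iff.2 hy]

/-- The positive function `|∇ρ|² + ρ²`. -/
def mass : Sm (Fin d → ℝ) := ∑ i, der i D.rho * der i D.rho + D.rho * D.rho

lemma mass_pos (y : Fin d → ℝ) : 0 < (D.mass : (Fin d → ℝ) → ℝ) y := by
  simp only [mass, AddMemClass.coe_add, Pi.add_apply, coe_sum, MulMemClass.coe_mul, Pi.mul_apply]
  by_cases hy : (D.rho : (Fin d → ℝ) → ℝ) y = 0
  · refine add_pos_of_pos_of_nonneg ?_ (mul_self_nonneg _)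
    by_contra hcon
    have h0 : ∀ i, (der i D.rho : (Fin d → ℝ) → ℝ) y = 0 := by
      have hle := le_antisymm (not_lt.1 hcon) (Finset.sum_nonneg fun i _ => mul_self_nonneg _)
      intro i
      exact mul_self_eq_zero.1
        ((Finset.sum_eq_zero_iff_of_nonneg fun i _ => mul_self_nonneg _).1 hle i (Finset.mem_univ i))
    refine D.grad_ne y (D.rho_eq_zero_iff.1 hy) (ContinuousLinearMap.ext fun e => ?_)
    have := dd_eq_sum D.rho y e
    simp only [h0, mul_zero, Finset.sum_const_zero] at this
    exact this
  · exact add_pos_of_nonneg_of_pos (Finset.sum_nonneg fun i _ => mul_self_nonneg _)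
      (mul_self_pos.2 hy)

/-- The inverse of `mass`. -/
def massInv : Sm (Fin d → ℝ) :=
  ⟨fun y => ((D.mass : (Fin d → ℝ) → ℝ) y)⁻¹, D.mass.contDiff.inv fun y => (D.mass_pos y).ne'⟩

lemma massInv_mul_mass : D.massInv * D.mass = 1 := by
  ext y
  exact inv_mul_cancel₀ (ne_of_gt (D.mass_pos y))

/-- The tangential part of `mass * ∂ₖ`. -/
def tang (k : Fin d) (v : Sm (Fin d → ℝ)) : Sm (Fin d → ℝ) :=
  ∑ i, der i D.rho * vf (D.fam (Sum.inl (i, k))) v + D.rho * vf (D.fam (Sum.inr k)) v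

lemma mass_mul_der (k : Fin d) (v : Sm (Fin d → ℝ)) :
    D.mass * der k v = D.tang k v + der k D.rho * ∑ i, der i D.rho * der i v := by
  simp only [mass, tang, vf_fam_inl, vf_fam_inr, add_mul, Finset.sum_mul, Finset.mul_sum]
  rw [add_right_comm, ← Finset.sum_add_distrib]
  congr 1
  · exact Finset.sum_congr rfl fun _ _ => by ring
  · ring

lemma mass_sq_mul_der_der (k l : Fin d) (w : Sm (Fin d → ℝ)) :
    D.mass * (D.mass * der k (der l w)) = D.mass * D.tang k (der l w) +
      der k D.rho * (∑ i, der i D.rho * D.tang l (der i w) +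
        der l D.rho * (D.mass * lap w - ∑ i, D.tang i (der i w))) := by
  have h1 : D.mass * ∑ i, der i D.rho * der i (der l w) = ∑ i, der i D.rho * D.tang l (der i w) +
      der l D.rho * ∑ i, der i D.rho * ∑ j, der j D.rho * der j (der i w) := by
    simp only [Finset.mul_sum (a := D.mass), Finset.mul_sum (a := der l D.rho),
      ← Finset.sum_add_distrib]
    refine Finset.sum_congr rfl fun i _ => ?_
    rw [dd_comm, mul_left_comm, D.mass_mul_der l (der i w)]
    ring
  have h2 : D.mass * lap w = ∑ i, D.tang i (der i w) +
      ∑ i, der i D.rho * ∑ j, der j D.rho * der j (der i w) := by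
    rw [lap_apply, Finset.mul_sum, ← Finset.sum_add_distrib]
    exact Finset.sum_congr rfl fun i _ => D.mass_mul_der i (der i w)
  rw [h2, D.mass_mul_der k (der l w), mul_add, mul_left_comm D.mass (der k D.rho), h1]
  ring

/-- Full derivatives are controlled by tangential derivatives and the Laplacian. -/
lemma H_add_two_dom {α : Type*} {B : α → ℝ} (hB : ∀ a, 0 ≤ B a) (n : ℕ)
    {w : α → Sm (Fin d → ℝ)} (h1 : Dom (fun a => D.H (n + 1) (w a)) B)
    (hlap : Dom (fun a => D.H n (lap (w a))) B)
    (hT : ∀ τ, Dom (fun a => D.H (n + 1) (vf (D.fam τ) (w a))) B) :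
    Dom (fun a => D.H (n + 2) (w a)) B := by
  have hTd : ∀ τ i, Dom (fun a => D.H n (vf (D.fam τ) (der i (w a)))) B := by
    intro τ i
    have h : ∀ a, vf (D.fam τ) (der i (w a)) =
        der i (vf (D.fam τ) (w a)) - vf (fun j => der i (D.fam τ j)) (w a) := fun a => by
      rw [der_vf, add_sub_cancel_right]
    simp only [h]
    exact dom_sub (dom_der i (hT τ)) (dom_vf _ h1)
  have htang : ∀ k i, Dom (fun a => D.H n (D.tang k (der i (w a)))) B := fun k i =>
    dom_add (dom_sum hB fun j _ => dom_mul _ (hTd _ i)) (dom_mul _ (hTd _ i))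
  have hdd : ∀ k l, Dom (fun a => D.H n (der k (der l (w a)))) B := by
    intro k l
    have h : ∀ a, der k (der l (w a)) =
        D.massInv * (D.massInv * (D.mass * (D.mass * der k (der l (w a))))) := fun a => by
      calc der k (der l (w a)) = (D.massInv * D.mass) * ((D.massInv * D.mass) *
            der k (der l (w a))) := by rw [massInv_mul_mass, one_mul, one_mul]
        _ = _ := by ring
    have heq : (fun a => D.H n (der k (der l (w a)))) = fun a => D.H n (D.massInv *
        (D.massInv * (D.mass * (D.mass * der k (der l (w a)))))) :=
      funext fun a => congrArg (D.H n) (h a)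
    rw [heq]
    simp only [mass_sq_mul_der_der]
    refine dom_mul _ (dom_mul _ (dom_add (dom_mul _ (htang k l)) (dom_mul _ (dom_add
      (dom_sum hB fun i _ => dom_mul _ (htang l i)) (dom_mul _ (dom_sub (dom_mul _ hlap)
        (dom_sum hB fun i _ => htang i i)))))))
  exact h1.add (Dom.sum hB fun l _ => (dom_der l h1).add (Dom.sum hB fun k _ => hdd k l))

lemma word_map_fam_dom (p : Prop) (k n : ℕ) (L : List ((Fin d × Fin d) ⊕ Fin d))
    (hL : L.length + n = k + 1) :
    Dom (fun v : {v // D.BC p v} => D.H (n + 1) (word (L.map D.fam) v.1))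
      (fun v => D.Ebd k v.1) := by
  induction n generalizing L with
  | zero =>
    rcases L with _ | ⟨τ, L⟩
    · simp at hL
    · have h := D.word_H_one_dom p (D.fam τ) (L.map D.fam) (by
        simp only [List.mem_cons, List.mem_map]
        rintro c (rfl | ⟨σ, -, rfl⟩) <;> exact D.fam_tangential _)
      have hk : (L.map D.fam).length = k := by
        simp only [List.length_cons] at hL
        rw [List.length_map]
        omega
      rwa [hk] at h
  | succ n ih =>
    refine D.H_add_two_dom (fun v => D.Ebd_nonneg _ _) n ?_ ?_ fun τ => ?_
    · refine ((D.word_dom _ (n + 1)).mono_right (D.H_le_Ebd ?_)).comp Subtype.val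
      rw [List.length_map]
      omega
    · refine ((D.lap_word_dom _ n).mono_right (D.Ebd_mono ?_)).comp Subtype.val
      rw [List.length_map]
      omega
    · refine ih (τ :: L) ?_
      rw [List.length_cons]
      omega

/-- Elliptic regularity: `‖v‖_{H^{k+2}} ≲ ‖Δv‖_{H^k} + ‖v‖_{H^1}` under the boundary condition. -/
theorem elliptic_dom (p : Prop) (k : ℕ) :
    Dom (fun v : {v // D.BC p v} => D.H (k + 2) v.1)
      (fun v => D.H k (lap v.1) + D.H 1 v.1) := by
  induction k with
  | zero => exact D.word_map_fam_dom p 0 1 [] rfl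
  | succ k ih =>
    refine (D.word_map_fam_dom p (k + 1) (k + 2) [] (by simp)).trans (Dom.add ?_ ?_)
    · exact Dom.of_le fun v => le_add_of_nonneg_right (D.H_nonneg _ _)
    · exact ih.mono_right fun v => add_le_add_left (D.H_le_succ _ _) _

end SmoothDomain

section Words

variable {ι γ γ' : Type*}

lemma opIter_map {F : ι → γ → γ} {G : ι → γ' → γ'} (c : γ → γ')
    (h : ∀ i u, G i (c u) = c (F i u)) (L : List ι) (u : γ) :
    opIter G L (c u) = c (opIter F L u) := by
  induction L with
  | nil => rfl
  | cons i L ih =>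
    change G i (opIter G L (c u)) = c (F i (opIter F L u))
    rw [ih, h]

lemma le_sum_words [Fintype ι] {q : List ι → ℝ} (hq : ∀ L, 0 ≤ q L) {n : ℕ} {L : List ι}
    (hL : L.length < n) :
    q L ≤ ∑ m ∈ Finset.range n, ∑ σ : Fin m → ι, q (List.ofFn σ) := by
  calc q L = q (List.ofFn L.get) := by rw [List.ofFn_get]
    _ ≤ ∑ σ : Fin L.length → ι, q (List.ofFn σ) :=
      Finset.single_le_sum (f := fun σ : Fin L.length → ι => q (List.ofFn σ))
        (fun _ _ => hq _) (Finset.mem_univ _)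
    _ ≤ _ := Finset.single_le_sum
        (f := fun m => ∑ σ : Fin m → ι, q (List.ofFn σ))
        (fun _ _ => Finset.sum_nonneg fun _ _ => hq _) (Finset.mem_range.2 hL)

end Words

namespace Waveguide

open Sm

variable {d : ℕ}

/-- Smooth functions of `((t,x),y)`. -/
abbrev JSm (d : ℕ) : Type := Sm ((Fin 4 → ℝ) × (Fin d → ℝ))

/-- The `i`-th derivative in `(t,x)`. -/
def tx (i : Fin 4) : JSm d →ₗ[ℝ] JSm d := dd (Pi.single i 1, 0)

/-- The `j`-th derivative in `y`. -/
def yy (j : Fin d) : JSm d →ₗ[ℝ] JSm d := dd (0, Pi.single j 1)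

/-- The derivatives in all of the variables `t,x,y`. -/
def mix : Fin 4 ⊕ Fin d → JSm d →ₗ[ℝ] JSm d
  | Sum.inl i => tx i
  | Sum.inr j => yy j

/-- The d'Alembertian. -/
def box : JSm d →ₗ[ℝ] JSm d :=
  tx 0 ∘ₗ tx 0 - tx 1 ∘ₗ tx 1 - tx 2 ∘ₗ tx 2 - tx 3 ∘ₗ tx 3 - ∑ j, yy j ∘ₗ yy j

/-- Restriction to the fibre over `z = (t,x)`. -/
def res (z : Fin 4 → ℝ) : JSm d →ₗ[ℝ] Sm (Fin d → ℝ) where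
  toFun f := ⟨fun y => (f : (Fin 4 → ℝ) × (Fin d → ℝ) → ℝ) (z, y),
    show ContDiff ℝ ∞ (fun y => (f : (Fin 4 → ℝ) × (Fin d → ℝ) → ℝ) (z, y)) from
      f.contDiff.comp (contDiff_const.prodMk contDiff_id)⟩
  map_add' _ _ := rfl
  map_smul' _ _ := rfl

/-- The curried form of a function of `((t,x),y)`. -/
def curry (f : JSm d) : (Fin 4 → ℝ) → (Fin d → ℝ) → ℝ := fun z y => (f : (Fin 4 → ℝ) × (Fin d → ℝ) → ℝ) (z, y)

lemma tx_tx_comm (i j : Fin 4) (f : JSm d) : tx i (tx j f) = tx j (tx i f) := dd_comm _ _ _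

lemma tx_yy_comm (i : Fin 4) (j : Fin d) (f : JSm d) : tx i (yy j f) = yy j (tx i f) :=
  dd_comm _ _ _

lemma mix_tx_comm (k : Fin 4 ⊕ Fin d) (i : Fin 4) (f : JSm d) :
    mix k (tx i f) = tx i (mix k f) := by
  cases k <;> exact dd_comm _ _ _

lemma box_apply (f : JSm d) : box f = tx 0 (tx 0 f) - tx 1 (tx 1 f) - tx 2 (tx 2 f) -
    tx 3 (tx 3 f) - ∑ j, yy j (yy j f) := by
  simp [box]

lemma box_tx (i : Fin 4) (f : JSm d) : box (tx i f) = tx i (box f) := by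
  simp only [box_apply, map_sub, map_sum, ← tx_yy_comm, tx_tx_comm _ i]

lemma pdtx_curry (i : Fin 4) (f : JSm d) : pdtx i (curry f) = curry (tx i f) := by
  funext z y
  have h1 : HasFDerivAt (fun z' : Fin 4 → ℝ => (z', y))
      (ContinuousLinearMap.inl ℝ (Fin 4 → ℝ) (Fin d → ℝ)) z := hasFDerivAt_prodMk_left z y
  have h2 := (f.differentiable (z, y)).hasFDerivAt.comp z h1
  change fderiv ℝ ((f : (Fin 4 → ℝ) × (Fin d → ℝ) → ℝ) ∘ fun z' : Fin 4 → ℝ => (z', y)) z (Pi.single i 1) = _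
  rw [h2.fderiv]
  rfl

lemma pdy_curry (j : Fin d) (f : JSm d) : pdy j (curry f) = curry (yy j f) := by
  funext z y
  have h1 : HasFDerivAt (fun y' : Fin d → ℝ => (z, y'))
      (ContinuousLinearMap.inr ℝ (Fin 4 → ℝ) (Fin d → ℝ)) y := hasFDerivAt_prodMk_right z y
  have h2 := (f.differentiable (z, y)).hasFDerivAt.comp y h1
  change fderiv ℝ ((f : (Fin 4 → ℝ) × (Fin d → ℝ) → ℝ) ∘ fun y' : Fin d → ℝ => (z, y')) y (Pi.single j 1) = _
  rw [h2.fderiv]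
  rfl

lemma pdmix_curry (k : Fin 4 ⊕ Fin d) (f : JSm d) : pdmix k (curry f) = curry (mix k f) := by
  cases k with
  | inl i => exact pdtx_curry i f
  | inr j => exact pdy_curry j f

lemma wBox_curry (f : JSm d) : wBox (curry f) = curry (box f) := by
  funext z y
  simp [wBox, pdtx_curry, pdy_curry, box_apply, curry]

lemma der_res (z : Fin 4 → ℝ) (j : Fin d) (f : JSm d) : der j (res z f) = res z (yy j f) := by
  ext y
  exact congrFun (congrFun (pdy_curry j f) z) y

lemma lap_res (z : Fin 4 → ℝ) (f : JSm d) :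
    lap (res z f) = res z (tx 0 (tx 0 f)) - res z (tx 1 (tx 1 f)) - res z (tx 2 (tx 2 f)) -
      res z (tx 3 (tx 3 f)) - res z (box f) := by
  simp only [lap_apply, der_res, box_apply, map_sub, map_sum]
  abel

variable (D : SmoothDomain d)

lemma L2y_curry (f : JSm d) (z : Fin 4 → ℝ) : L2y D (curry f) z = D.nrm (res z f) := by
  simp only [L2y, SmoothDomain.nrm, SmoothDomain.ip_apply, pow_two]
  rfl

lemma tx_eq_zero {f : JSm d} {y : Fin d → ℝ} (h : ∀ z, (f : (Fin 4 → ℝ) × (Fin d → ℝ) → ℝ) (z, y) = 0) (i : Fin 4)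
    (z : Fin 4 → ℝ) : (tx i f : (Fin 4 → ℝ) × (Fin d → ℝ) → ℝ) (z, y) = 0 := by
  have := congrFun (congrFun (pdtx_curry i f) z) y
  rw [curry] at this
  rw [← this]
  simp [pdtx, curry, h]

variable {D} {p : Prop} {f : JSm d}

lemma BC_tx (hf : ∀ z, D.BC p (res z f)) (i : Fin 4) (z : Fin 4 → ℝ) :
    D.BC p (res z (tx i f)) := by
  refine ⟨fun hp y hy => tx_eq_zero (fun z' => (hf z').1 hp y hy) i z, fun hp y hy => ?_⟩
  have h0 : ∀ z', ((∑ j, (der j D.rho : (Fin d → ℝ) → ℝ) y • yy j f : JSm d) : (Fin 4 → ℝ) × (Fin d → ℝ) → ℝ) (z', y)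
      = 0 := by
    intro z'
    have := (hf z').2 hp y hy
    rw [coe_sum] at this ⊢
    rw [← this]
    refine Finset.sum_congr rfl fun j _ => ?_
    beta_reduce
    rw [der_res]
    exact mul_comm _ _
  have h1 := tx_eq_zero h0 i z
  simp only [map_sum, map_smul, tx_yy_comm] at h1
  rw [coe_sum] at h1 ⊢
  rw [← h1]
  refine Finset.sum_congr rfl fun j _ => ?_
  beta_reduce
  rw [der_res]
  exact mul_comm _ _

variable (D) in
/-- `W` bounds all the terms on the right-hand side of the elliptic estimate of order `N`. -/
structure Bdd (N : ℕ) (z : Fin 4 → ℝ) (f : JSm d) (W : ℝ) : Prop where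
  tx_le : ∀ L : List (Fin 4), L.length ≤ N → D.nrm (res z (opIter (tx ·) L f)) ≤ W
  yy_le : ∀ (L : List (Fin 4)) (j : Fin d), L.length < N →
    D.nrm (res z (opIter (tx ·) L (yy j f))) ≤ W
  box_le : ∀ L : List (Fin 4 ⊕ Fin d), L.length + 2 ≤ N →
    D.nrm (res z (opIter (mix ·) L (box f))) ≤ W

lemma Bdd.tx_tx {N : ℕ} {z : Fin 4 → ℝ} {W : ℝ} (h : Bdd D (N + 2) z f W) (i : Fin 4) :
    Bdd D N z (tx i (tx i f)) W where
  tx_le L hL := by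
    rw [opIter_map (fun g => tx i (tx i g)) fun k u => by rw [tx_tx_comm, tx_tx_comm k]]
    exact h.tx_le (i :: i :: L) (by simpa using hL)
  yy_le L j hL := by
    rw [← tx_yy_comm, ← tx_yy_comm,
      opIter_map (fun g => tx i (tx i g)) fun k u => by rw [tx_tx_comm, tx_tx_comm k]]
    exact h.yy_le (i :: i :: L) j (by simpa using hL)
  box_le L hL := by
    rw [box_tx, box_tx,
      opIter_map (fun g => tx i (tx i g)) fun k u => by rw [mix_tx_comm, mix_tx_comm k]]
    exact h.box_le (Sum.inl i :: Sum.inl i :: L) (by simp only [List.length_cons]; omega)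

variable (D) in
lemma H_res_le (n : ℕ) (z : Fin 4 → ℝ) (W : ℝ) (w : JSm d)
    (h : ∀ L : List (Fin 4 ⊕ Fin d), L.length ≤ n → D.nrm (res z (opIter (mix ·) L w)) ≤ W) :
    D.H n (res z w) ≤ (1 + d) ^ n * W := by
  have key : ∀ (n : ℕ) (L : List (Fin 4 ⊕ Fin d)), (∀ L' : List (Fin 4 ⊕ Fin d),
      L'.length ≤ n + L.length → D.nrm (res z (opIter (mix ·) L' w)) ≤ W) →
      D.H n (res z (opIter (mix ·) L w)) ≤ (1 + d) ^ n * W := by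
    intro n
    induction n with
    | zero => intro L hL; simpa [SmoothDomain.H] using hL L (by simp)
    | succ n ih =>
      intro L hL
      have h1 := ih L fun L' hL' => hL L' (by omega)
      have h2 : ∀ j : Fin d, D.H n (der j (res z (opIter (mix ·) L w))) ≤ (1 + d) ^ n * W := by
        intro j
        rw [der_res]
        exact ih (Sum.inr j :: L) fun L' hL' => hL L' (by simp at hL'; omega)
      calc D.H (n + 1) (res z (opIter (mix ·) L w))
          ≤ (1 + d) ^ n * W + ∑ _j : Fin d, (1 + d) ^ n * W :=
            add_le_add h1 (Finset.sum_le_sum fun j _ => h2 j)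
        _ = _ := by simp; ring
  exact key n [] (by simpa using h)

variable (D) in
/-- Elliptic regularity on the fibres of the waveguide. -/
lemma exists_H_res_le (p : Prop) (N : ℕ) : ∃ C : ℝ, 0 ≤ C ∧
    ∀ (f : JSm d) (z : Fin 4 → ℝ) (W : ℝ), (∀ z, D.BC p (res z f)) → Bdd D N z f W →
      D.H N (res z f) ≤ C * W := by
  have h1 : ∀ (f : JSm d) (z : Fin 4 → ℝ) (W : ℝ) (n : ℕ), Bdd D (n + 1) z f W →
      D.H 1 (res z f) ≤ (1 + d) * W := by
    intro f z W n h
    calc D.H 1 (res z f) ≤ W + ∑ _j : Fin d, W := by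
          refine add_le_add (h.tx_le [] (by simp)) (Finset.sum_le_sum fun j _ => ?_)
          rw [der_res]
          exact h.yy_le [] j (by simp)
      _ = _ := by simp; ring
  induction N using Nat.twoStepInduction with
  | zero => exact ⟨1, zero_le_one, fun f z W _ h => by
      rw [one_mul]
      exact h.tx_le [] (by simp)⟩
  | one => exact ⟨1 + d, by positivity, fun f z W _ h => h1 f z W 0 h⟩
  | more n ih _ =>
    obtain ⟨C, hC, ih⟩ := ih
    obtain ⟨K, hK, hell⟩ := D.elliptic_dom p n
    refine ⟨K * (4 * C + (1 + d) ^ n + (1 + d)), by positivity, fun f z W hf h => ?_⟩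
    have hi : ∀ i, D.H n (res z (tx i (tx i f))) ≤ C * W := fun i =>
      ih _ z W (BC_tx (BC_tx hf i) i) (h.tx_tx i)
    have hb : D.H n (res z (box f)) ≤ (1 + d) ^ n * W :=
      H_res_le D n z W _ fun L hL => h.box_le L (by omega)
    have hl : D.H n (lap (res z f)) ≤ (4 * C + (1 + d) ^ n) * W := by
      rw [lap_res]
      have sub_le : ∀ a b, D.H n (a - b) ≤ D.H n a + D.H n b := fun a b => by
        simpa only [sub_eq_add_neg, D.H_neg] using D.H_add_le n a (-b)
      linarith [sub_le (res z (tx 0 (tx 0 f)) - res z (tx 1 (tx 1 f)) - res z (tx 2 (tx 2 f)) -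
          res z (tx 3 (tx 3 f))) (res z (box f)),
        sub_le (res z (tx 0 (tx 0 f)) - res z (tx 1 (tx 1 f)) - res z (tx 2 (tx 2 f)))
          (res z (tx 3 (tx 3 f))),
        sub_le (res z (tx 0 (tx 0 f)) - res z (tx 1 (tx 1 f))) (res z (tx 2 (tx 2 f))),
        sub_le (res z (tx 0 (tx 0 f))) (res z (tx 1 (tx 1 f))), hi 0, hi 1, hi 2, hi 3]
    calc D.H (n + 2) (res z f)
        ≤ K * (D.H n (lap (res z f)) + D.H 1 (res z f)) := hell ⟨res z f, hf z⟩
      _ ≤ K * ((4 * C + (1 + d) ^ n) * W + (1 + d) * W) := by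
        gcongr
        exact h1 f z W (n + 1) h
      _ = _ := by ring

variable (D) in
lemma H_res_opIter_le (L : List (Fin d)) (m : ℕ) (z : Fin 4 → ℝ) (f : JSm d) :
    D.H m (res z (opIter (yy ·) L f)) ≤ D.H (m + L.length) (res z f) := by
  induction L generalizing m with
  | nil => exact le_rfl
  | cons j L ih =>
    calc D.H m (res z (yy j (opIter (yy ·) L f)))
        ≤ D.H (m + 1) (res z (opIter (yy ·) L f)) := by
          rw [← der_res]
          exact D.H_der_le m j _
      _ ≤ D.H (m + 1 + L.length) (res z f) := ih (m + 1)
      _ = _ := by rw [List.length_cons]; congr 1; omega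

lemma L2y_opIter {ι : Type*} {G : ι → ((Fin 4 → ℝ) → (Fin d → ℝ) → ℝ) →
    (Fin 4 → ℝ) → (Fin d → ℝ) → ℝ} {F : ι → JSm d →ₗ[ℝ] JSm d}
    (h : ∀ i u, G i (curry u) = curry (F i u)) (L : List ι) (g : JSm d) (z : Fin 4 → ℝ) :
    L2y D (opIter G L (curry g)) z = D.nrm (res z (opIter (F ·) L g)) := by
  rw [opIter_map curry h, L2y_curry]

end Waveguide

end EllipticRegularity

/-- elliptic regularity on the waveguide: let `Ω ⊂ ℝ^d` be a nonempty
bounded domain with smooth boundary.  For every integer `N ≥ 2` there is a constant `C` such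
that for every `u ∈ C^∞(ℝ₊×ℝ³×Ω̄)` satisfying the Dirichlet or Neumann boundary condition and
every `(t,x)`,
`Σ_{|α|≤N} ‖∂_y^α u(t,x,·)‖_{L²(Ω)} ≤ C Σ_{|α|+|β|≤N, |β|≤1} ‖∂_{t,x}^α ∂_y^β u(t,x,·)‖_{L²(Ω)}
  + C Σ_{|α|≤N-2} ‖∂_{t,x,y}^α □u(t,x,·)‖_{L²(Ω)}`. -/
theorem stmt14 (d : ℕ) (D : SmoothDomain d) (N : ℕ) (hN : 2 ≤ N) :
    ∃ C : ℝ, 0 < C ∧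
      ∀ u : (Fin 4 → ℝ) → (Fin d → ℝ) → ℝ, SmoothC u →
        (DirichletBC D u ∨ NeumannBC D u) →
        ∀ z : Fin 4 → ℝ, 0 ≤ z 0 →
          (∑ n ∈ Finset.range (N + 1), ∑ σ : Fin n → Fin d,
              L2y D (opIter pdy (List.ofFn σ) u) z) ≤
            C * ((∑ n ∈ Finset.range (N + 1), ∑ σ : Fin n → Fin 4,
                  L2y D (opIter pdtx (List.ofFn σ) u) z) +
                (∑ n ∈ Finset.range N, ∑ σ : Fin n → Fin 4, ∑ j : Fin d,
                  L2y D (opIter pdtx (List.ofFn σ) (pdy j u)) z)) +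
            C * (∑ n ∈ Finset.range (N - 1), ∑ σ : Fin n → (Fin 4 ⊕ Fin d),
                L2y D (opIter pdmix (List.ofFn σ) (wBox u)) z) := by
  obtain ⟨C₁, hC₁, h₁⟩ := Waveguide.exists_H_res_le D True N
  obtain ⟨C₂, hC₂, h₂⟩ := Waveguide.exists_H_res_le D False N
  obtain ⟨c, hc⟩ : ∃ c : ℝ, c = ∑ n ∈ Finset.range (N + 1), ∑ _σ : Fin n → Fin d, (1 : ℝ) :=
    ⟨_, rfl⟩
  have hc0 : 0 ≤ c := hc ▸ Finset.sum_nonneg fun _ _ => Finset.sum_nonneg fun _ _ => zero_le_one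
  refine ⟨c * (C₁ + C₂) + 1, by positivity, fun u hu hbc z _ => ?_⟩
  obtain ⟨f, rfl⟩ : ∃ f : Waveguide.JSm d, u = Waveguide.curry f := ⟨⟨_, hu⟩, rfl⟩
  simp only [Waveguide.wBox_curry, Waveguide.pdy_curry,
    Waveguide.L2y_opIter Waveguide.pdtx_curry, Waveguide.L2y_opIter Waveguide.pdy_curry,
    Waveguide.L2y_opIter Waveguide.pdmix_curry]
  generalize hA : ∑ n ∈ Finset.range (N + 1), ∑ σ : Fin n → Fin 4,
    D.nrm (Waveguide.res z (opIter (Waveguide.tx ·) (List.ofFn σ) f)) = A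
  generalize hB : ∑ n ∈ Finset.range N, ∑ σ : Fin n → Fin 4, ∑ j : Fin d,
    D.nrm (Waveguide.res z (opIter (Waveguide.tx ·) (List.ofFn σ) (Waveguide.yy j f))) = B
  generalize hM : ∑ n ∈ Finset.range (N - 1), ∑ σ : Fin n → (Fin 4 ⊕ Fin d),
    D.nrm (Waveguide.res z (opIter (Waveguide.mix ·) (List.ofFn σ) (Waveguide.box f))) = M
  have hA0 : 0 ≤ A := hA ▸ Finset.sum_nonneg fun _ _ => Finset.sum_nonneg fun _ _ => D.nrm_nonneg _
  have hB0 : 0 ≤ B := hB ▸ Finset.sum_nonneg fun _ _ => Finset.sum_nonneg fun _ _ =>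
    Finset.sum_nonneg fun _ _ => D.nrm_nonneg _
  have hM0 : 0 ≤ M := hM ▸ Finset.sum_nonneg fun _ _ => Finset.sum_nonneg fun _ _ => D.nrm_nonneg _
  have hbdd : Waveguide.Bdd D N z f (A + B + M) := by
    refine ⟨fun L hL => ?_, fun L j hL => ?_, fun L hL => ?_⟩
    · have := le_sum_words
        (q := fun L => D.nrm (Waveguide.res z (opIter (Waveguide.tx ·) L f)))
        (fun _ => D.nrm_nonneg _) (Nat.lt_succ_of_le hL)
      linarith
    · have h1 := Finset.single_le_sum
        (f := fun j => D.nrm (Waveguide.res z (opIter (Waveguide.tx ·) L (Waveguide.yy j f))))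
        (fun _ _ => D.nrm_nonneg _) (Finset.mem_univ j)
      have h2 := le_sum_words (q := fun L => ∑ j, D.nrm (Waveguide.res z
          (opIter (Waveguide.tx ·) L (Waveguide.yy j f))))
        (fun _ => Finset.sum_nonneg fun _ _ => D.nrm_nonneg _) hL
      linarith
    · have := le_sum_words (q := fun L => D.nrm (Waveguide.res z
          (opIter (Waveguide.mix ·) L (Waveguide.box f))))
        (fun _ => D.nrm_nonneg _) (n := N - 1) (L := L) (by omega)
      linarith
  have hH : D.H N (Waveguide.res z f) ≤ (C₁ + C₂) * (A + B + M) := by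
    have hW : 0 ≤ A + B + M := by positivity
    rcases hbc with h | h
    · have := h₁ f z _ (fun z' => ⟨fun _ => h z', fun hn => absurd trivial hn⟩) hbdd
      nlinarith [mul_nonneg hC₂ hW]
    · have := h₂ f z _ (fun z' => ⟨False.elim, fun _ y hy => by
        rw [Sm.coe_sum, ← h z' y hy]
        exact Finset.sum_congr rfl fun j _ => mul_comm _ _⟩) hbdd
      nlinarith [mul_nonneg hC₁ hW]
  calc ∑ n ∈ Finset.range (N + 1), ∑ σ : Fin n → Fin d,
        D.nrm (Waveguide.res z (opIter (Waveguide.yy ·) (List.ofFn σ) f))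
      ≤ ∑ n ∈ Finset.range (N + 1), ∑ _σ : Fin n → Fin d, 1 * D.H N (Waveguide.res z f) := by
        refine Finset.sum_le_sum fun n hn => Finset.sum_le_sum fun σ _ => ?_
        rw [one_mul]
        refine (Waveguide.H_res_opIter_le D (List.ofFn σ) 0 z f).trans (D.H_mono ?_ _)
        simp only [List.length_ofFn, Finset.mem_range] at hn ⊢
        omega
    _ = c * D.H N (Waveguide.res z f) := by simp only [hc, Finset.sum_mul]
    _ ≤ c * ((C₁ + C₂) * (A + B + M)) := by gcongr
    _ ≤ (c * (C₁ + C₂) + 1) * (A + B) + (c * (C₁ + C₂) + 1) * M := by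
        nlinarith
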